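/- arXiv:1703.08854 — 4 statements merged into one kernel-verified Lean document; each statement's English description precedes it below -/
import Mathlib

section
/- Let N and N₂ be positive integers with 1 ≤ N₂ < min{4, N}. Let S be a positive-definite real symmetric N×N matrix and S₂ a positive-definite real symmetric N₂×N₂ matrix. Then the set of rational representations of S is not contained in that of S₂: {xᵀSx : 0 ≠ x ∈ ℚᴺ} ⊄ {yᵀS₂y : 0 ≠ y ∈ ℚᴺ²}. In particular, {xᵀSx : 0 ≠ x ∈ ℤᴺ} ⊄ {yᵀS₂y : 0 ≠ y ∈ ℤᴺ²}. -/
open Matrix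

/-- The diagonal quadratic form with coefficients `c` has a nontrivial zero. -/
def DiagIsotropic {K ι : Type*} [Field K] [Fintype ι] (c : ι → K) : Prop :=
  ∃ x : ι → K, x ≠ 0 ∧ ∑ i, c i * x i ^ 2 = 0

theorem DiagIsotropic.of_comp {K ι κ : Type*} [Field K] [Fintype ι] [Fintype κ] {c : ι → K}
    {σ : κ → ι} (hσ : Function.Injective σ) (h : DiagIsotropic (c ∘ σ)) : DiagIsotropic c := by
  obtain ⟨x, hx, h0⟩ := h
  refine ⟨Function.extend σ x 0, ?_, ?_⟩
  · intro h
    apply hx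
    funext k
    have := congrFun h (σ k)
    rwa [hσ.extend_apply] at this
  · rw [← h0]
    symm
    refine Fintype.sum_of_injective σ hσ _ _ ?_ ?_
    · intro i hi
      rw [Function.extend_apply' _ _ _ (by simpa using hi)]
      simp
    · intro k
      simp [hσ.extend_apply]

theorem DiagIsotropic.of_mul_sq {K ι : Type*} [Field K] [Fintype ι] {c s : ι → K} {a : K}
    (ha : a ≠ 0) (hs : ∀ i, s i ≠ 0) (h : DiagIsotropic fun i => a * c i * s i ^ 2) :
    DiagIsotropic c := by
  obtain ⟨x, hx, h0⟩ := h
  refine ⟨fun i => s i * x i, ?_, ?_⟩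
  · intro h
    apply hx
    funext i
    have := congrFun h i
    simpa [hs i] using this
  · apply mul_left_cancel₀ ha
    rw [mul_zero, ← h0, Finset.mul_sum]
    exact Finset.sum_congr rfl fun i _ => by ring

section Padic

variable {p : ℕ} [hp : Fact p.Prime]

theorem PadicInt.exists_mul_sq_add_eq_zero {u c : ℤ_[p]} (h : ‖u + c‖ < ‖2 * u‖ ^ 2) :
    ∃ z : ℤ_[p], z ≠ 0 ∧ u * z ^ 2 + c = 0 := by
  let F : Polynomial ℤ_[p] := Polynomial.C u * Polynomial.X ^ 2 + Polynomial.C c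
  have h1 : F.aeval (1 : ℤ_[p]) = u + c := by simp [F]
  have h2 : F.derivative.aeval (1 : ℤ_[p]) = 2 * u := by
    simp [F]
    ring
  obtain ⟨z, hz, -⟩ := hensels_lemma (F := F) (a := (1 : ℤ_[p])) (by rw [h1, h2]; exact h)
  have hz' : u * z ^ 2 + c = 0 := by simpa [F] using hz
  refine ⟨z, ?_, hz'⟩
  rintro rfl
  have hc : c = 0 := by simpa using hz'
  rw [hc, add_zero, norm_mul] at h
  have h3 := norm_le_one (2 : ℤ_[p])
  have h4 := norm_le_one u
  have h5 := norm_nonneg u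
  have h6 := norm_nonneg (2 : ℤ_[p])
  nlinarith [mul_le_one₀ h3 h5 h4, mul_nonneg h6 h5, mul_le_of_le_one_left h5 h3]

theorem PadicInt.exists_unit_form_three (hp2 : p ≠ 2) (u : Fin 3 → ℤ_[p]ˣ) :
    DiagIsotropic fun i => ((u i : ℤ_[p]) : ℚ_[p]) := by
  have : ∃ a b : ℤ_[p], ‖(u 2 : ℤ_[p]) + (u 0 * a ^ 2 + u 1 * b ^ 2)‖ < 1 := by
    let φ := PadicInt.toZMod (p := p)
    have hu : ∀ i, φ (u i) ≠ 0 := fun i => ((u i).isUnit.map φ).ne_zero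
    obtain ⟨a, b, hab⟩ := FiniteField.exists_root_sum_quadratic
      (f := Polynomial.C (φ (u 0)) * Polynomial.X ^ 2)
      (g := Polynomial.C (φ (u 1)) * Polynomial.X ^ 2 + Polynomial.C (φ (u 2)))
      (by rw [Polynomial.degree_C_mul_X_pow 2 (hu 0)]; rfl)
      (by
        rw [Polynomial.degree_add_C]
        · rw [Polynomial.degree_C_mul_X_pow 2 (hu 1)]; rfl
        · rw [Polynomial.degree_C_mul_X_pow 2 (hu 1)]; decide)
      (by rw [ZMod.card]; exact (hp.out.eq_two_or_odd).resolve_left hp2)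
    obtain ⟨a, rfl⟩ := ZMod.ringHom_surjective φ a
    obtain ⟨b, rfl⟩ := ZMod.ringHom_surjective φ b
    refine ⟨a, b, ?_⟩
    rw [← PadicInt.mem_nonunits, ← IsLocalRing.mem_maximalIdeal, ← PadicInt.ker_toZMod,
      RingHom.mem_ker]
    simp only [Polynomial.eval_add, Polynomial.eval_mul, Polynomial.eval_C, Polynomial.eval_pow,
      Polynomial.eval_X] at hab
    simp only [map_add, map_mul, map_pow]
    rw [← hab]
    ring
  obtain ⟨a, b, hab⟩ := this
  have h2 : ‖(2 : ℤ_[p])‖ = 1 := by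
    have := PadicInt.norm_natCast_eq_one_iff (p := p) (n := 2)
    rw [Nat.cast_ofNat] at this
    exact this.2 ((Nat.coprime_primes hp.out Nat.prime_two).2 hp2)
  obtain ⟨z, hz, h⟩ := PadicInt.exists_mul_sq_add_eq_zero (u := (u 2 : ℤ_[p]))
    (c := u 0 * a ^ 2 + u 1 * b ^ 2) (by rw [norm_mul, h2, PadicInt.norm_units]; simpa using hab)
  refine ⟨![a, b, z], fun h0 => hz ?_, ?_⟩
  · simpa using congrFun h0 2
  · simp only [Fin.sum_univ_three]
    have := congrArg (fun t : ℤ_[p] => (t : ℚ_[p])) h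
    push_cast at this
    simp only [cons_val]
    linear_combination this

end Padic

theorem PadicInt.two_dvd_unit_add_unit (u v : ℤ_[2]ˣ) : (2 : ℤ_[2]) ∣ u + v := by
  have key : ∀ t : ℤ_[2], (2 : ℤ_[2]) ∣ t ↔ PadicInt.toZMod t = 0 := by
    intro t
    rw [← RingHom.mem_ker, PadicInt.ker_toZMod, PadicInt.maximalIdeal_eq_span_p,
      Ideal.mem_span_singleton]
    simp
  rw [key, map_add]
  have h : ∀ a b : ZMod 2, a ≠ 0 → b ≠ 0 → a + b = 0 := by decide
  exact h _ _ ((u.isUnit.map PadicInt.toZMod).ne_zero) ((v.isUnit.map PadicInt.toZMod).ne_zero)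

theorem PadicInt.two_dvd_or_isUnit (t : ℤ_[2]) : (2 : ℤ_[2]) ∣ t ∨ IsUnit t := by
  by_cases h : IsUnit t
  · exact Or.inr h
  · rw [PadicInt.not_isUnit_iff, PadicInt.norm_lt_one_iff_dvd] at h
    exact Or.inl (by simpa using h)

theorem PadicInt.exists_mul_sq_add_eq_zero_of_eight_dvd {u : ℤ_[2]ˣ} {c : ℤ_[2]}
    (h : (8 : ℤ_[2]) ∣ u + c) : ∃ z : ℤ_[2], z ≠ 0 ∧ u * z ^ 2 + c = 0 := by
  have h2 : ‖(2 : ℤ_[2])‖ = 2⁻¹ := by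
    have := PadicInt.norm_p (p := 2)
    simpa using this
  apply PadicInt.exists_mul_sq_add_eq_zero
  obtain ⟨k, hk⟩ := h
  rw [hk, norm_mul, norm_mul, PadicInt.norm_units, show (8 : ℤ_[2]) = 2 ^ 3 by norm_num, norm_pow,
    h2]
  have := PadicInt.norm_le_one k
  norm_num
  linarith

theorem PadicInt.eight_dvd_of_four_dvd {t : ℤ_[2]} (u : ℤ_[2]ˣ) (h : (4 : ℤ_[2]) ∣ t) :
    ∃ s, (8 : ℤ_[2]) ∣ t + u * s ^ 2 := by
  obtain ⟨b, rfl⟩ := h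
  rcases PadicInt.two_dvd_or_isUnit b with ⟨k, rfl⟩ | ⟨b, rfl⟩
  · exact ⟨0, k, by ring⟩
  · refine ⟨2 * b, ?_⟩
    obtain ⟨k, hk⟩ := PadicInt.two_dvd_unit_add_unit 1 (u * b)
    refine ⟨b * k, ?_⟩
    push_cast at hk
    linear_combination 4 * (b : ℤ_[2]) * hk

theorem PadicInt.exists_form_four_two (u : Fin 3 → ℤ_[2]ˣ) (v : ℤ_[2]ˣ) :
    DiagIsotropic ![((u 0 : ℤ_[2]) : ℚ_[2]), ((u 1 : ℤ_[2]) : ℚ_[2]), ((u 2 : ℤ_[2]) : ℚ_[2]),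
      2 * ((v : ℤ_[2]) : ℚ_[2])] := by
  obtain ⟨a, ha⟩ := PadicInt.two_dvd_unit_add_unit (u 0) (u 1)
  have h4 : (4 : ℤ_[2]) ∣ u 0 + u 1 + 2 * v * a ^ 2 := by
    rw [ha]
    rcases PadicInt.two_dvd_or_isUnit a with ⟨k, rfl⟩ | ⟨a, rfl⟩
    · exact ⟨k + 2 * v * k ^ 2, by ring⟩
    · obtain ⟨k, hk⟩ := PadicInt.two_dvd_unit_add_unit 1 (v * a)
      refine ⟨a * k, ?_⟩
      push_cast at hk
      linear_combination 2 * (a : ℤ_[2]) * hk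
  obtain ⟨s, hs⟩ := PadicInt.eight_dvd_of_four_dvd (u 2) h4
  obtain ⟨z, hz, h⟩ := PadicInt.exists_mul_sq_add_eq_zero_of_eight_dvd (u := u 0)
    (c := u 1 + 2 * v * a ^ 2 + u 2 * s ^ 2) (by convert hs using 1; ring)
  refine ⟨![z, 1, s, a], fun h0 => hz ?_, ?_⟩
  · simpa using congrFun h0 0
  · simp only [Fin.sum_univ_four]
    have := congrArg (fun t : ℤ_[2] => (t : ℚ_[2])) h
    have h2 : ((2 : ℤ_[2]) : ℚ_[2]) = 2 := rfl
    push_cast [h2] at this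
    simp only [cons_val]
    linear_combination this

theorem PadicInt.exists_unit_form_five_two (u : Fin 5 → ℤ_[2]ˣ) :
    DiagIsotropic fun i => ((u i : ℤ_[2]) : ℚ_[2]) := by
  obtain ⟨a, ha⟩ := PadicInt.two_dvd_unit_add_unit (u 0) (u 1)
  obtain ⟨b, hb⟩ := PadicInt.two_dvd_unit_add_unit (u 2) (u 3)
  have finish : ∀ e : ℤ_[2], (4 : ℤ_[2]) ∣ u 0 + u 1 + (u 2 + u 3) * e ^ 2 →
      DiagIsotropic fun i => ((u i : ℤ_[2]) : ℚ_[2]) := by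
    intro e h4
    obtain ⟨s, hs⟩ := PadicInt.eight_dvd_of_four_dvd (u 4) h4
    obtain ⟨z, hz, h⟩ := PadicInt.exists_mul_sq_add_eq_zero_of_eight_dvd (u := u 0)
      (c := u 1 + (u 2 + u 3) * e ^ 2 + u 4 * s ^ 2) (by convert hs using 1; ring)
    refine ⟨![z, 1, e, e, s], fun h0 => hz ?_, ?_⟩
    · simpa using congrFun h0 0
    · simp only [Fin.sum_univ_five]
      have := congrArg (fun t : ℤ_[2] => (t : ℚ_[2])) h
      push_cast at this
      simp only [cons_val]
      linear_combination this
  rcases PadicInt.two_dvd_or_isUnit a with ⟨k, hk⟩ | ⟨a, rfl⟩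
  · exact finish 0 ⟨k, by rw [ha, hk]; ring⟩
  rcases PadicInt.two_dvd_or_isUnit b with ⟨k, rfl⟩ | ⟨b, rfl⟩
  · obtain ⟨s, hs⟩ := PadicInt.eight_dvd_of_four_dvd (u 4) (t := u 2 + u 3) ⟨k, by rw [hb]; ring⟩
    obtain ⟨z, hz, h⟩ := PadicInt.exists_mul_sq_add_eq_zero_of_eight_dvd (u := u 2)
      (c := u 3 + u 4 * s ^ 2) (by convert hs using 1; ring)
    refine ⟨![0, 0, z, 1, s], fun h0 => hz ?_, ?_⟩
    · simpa using congrFun h0 2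
    · simp only [Fin.sum_univ_five]
      have := congrArg (fun t : ℤ_[2] => (t : ℚ_[2])) h
      push_cast at this
      simp only [cons_val]
      linear_combination this
  · refine finish 1 ?_
    obtain ⟨k, hk⟩ := PadicInt.two_dvd_unit_add_unit a b
    exact ⟨k, by linear_combination ha + hb + 2 * hk⟩

theorem Padic.exists_eq_unit_mul_sq {p : ℕ} [hp : Fact p.Prime] {c : ℚ_[p]} (hc : c ≠ 0) :
    ∃ (e : Fin 2) (u : ℤ_[p]ˣ) (s : ℚ_[p]), s ≠ 0 ∧
      c * s ^ 2 = (p : ℚ_[p]) ^ (e : ℕ) * ((u : ℤ_[p]) : ℚ_[p]) := by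
  have hp0 : (p : ℚ_[p]) ≠ 0 := by exact_mod_cast hp.out.ne_zero
  have hn : ‖c * (p : ℚ_[p]) ^ (-c.valuation)‖ = 1 := by
    rw [norm_mul, Padic.norm_eq_zpow_neg_valuation hc, Padic.norm_p_zpow, neg_neg,
      ← zpow_add₀ (by exact_mod_cast hp.out.ne_zero)]
    simp
  have hdiv := Int.emod_add_mul_ediv c.valuation 2
  rcases Int.emod_two_eq_zero_or_one c.valuation with h | h
  · refine ⟨0, PadicInt.mkUnits hn, (p : ℚ_[p]) ^ (-(c.valuation / 2)), zpow_ne_zero _ hp0, ?_⟩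
    rw [PadicInt.mkUnits_eq, ← zpow_natCast, ← _root_.zpow_mul]
    simp only [Fin.val_zero, pow_zero, one_mul]
    congr 2
    push_cast
    omega
  · refine ⟨1, PadicInt.mkUnits hn, (p : ℚ_[p]) ^ (-(c.valuation / 2)), zpow_ne_zero _ hp0, ?_⟩
    rw [PadicInt.mkUnits_eq, ← zpow_natCast, ← _root_.zpow_mul, mul_left_comm, ← zpow_natCast,
      ← zpow_add₀ hp0]
    congr 2
    simp
    omega

/-- Every diagonal form in five variables over `ℚ_[p]` is isotropic. -/
theorem Padic.diagIsotropic_five {p : ℕ} [hp : Fact p.Prime] (c : Fin 5 → ℚ_[p]) :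
    DiagIsotropic c := by
  have hp0 : (p : ℚ_[p]) ≠ 0 := by exact_mod_cast hp.out.ne_zero
  by_cases hc : ∃ i, c i = 0
  · obtain ⟨i, hi⟩ := hc
    refine ⟨Pi.single i 1, by simp, ?_⟩
    rw [Finset.sum_eq_single i]
    · simp [hi]
    · intro j _ hj
      simp [hj]
    · simp
  push Not at hc
  choose e u s hs h using fun i => Padic.exists_eq_unit_mul_sq (hc i)
  have scale : ∀ {n : ℕ} (σ : Fin n → Fin 5) (b : Fin 2), Function.Injective σ →
      (∀ i, e (σ i) = b) → DiagIsotropic (fun i => ((u (σ i) : ℤ_[p]) : ℚ_[p])) →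
      DiagIsotropic c := by
    intro n σ b hσ he hi
    refine DiagIsotropic.of_comp hσ (DiagIsotropic.of_mul_sq (a := ((p : ℚ_[p]) ^ (b : ℕ))⁻¹)
      (s := s ∘ σ) (inv_ne_zero (pow_ne_zero _ hp0)) (fun i => hs _) ?_)
    convert hi using 2 with i
    simp only [Function.comp]
    rw [mul_assoc, h, he, inv_mul_cancel_left₀ (pow_ne_zero _ hp0)]
  by_cases hp2 : p = 2
  · subst hp2
    have hcomb : ∀ e : Fin 5 → Fin 2, (∃ b, ∀ i, e i = b) ∨
        ∃ i j k l : Fin 5, [i, j, k, l].Nodup ∧ e i = e j ∧ e j = e k ∧ e l ≠ e k := by decide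
    rcases hcomb e with ⟨b, hb⟩ | ⟨i, j, k, l, hnd, hij, hjk, hlk⟩
    · exact scale id b Function.injective_id hb (PadicInt.exists_unit_form_five_two u)
    · have hinj : Function.Injective ![i, j, k, l] := by
        have := List.nodup_ofFn (f := ![i, j, k, l])
        rw [← this]
        simpa [List.ofFn_succ] using hnd
      have hσ := PadicInt.exists_form_four_two (![u i, u j, u k]) (u l)
      simp only [cons_val] at hσ
      have h01 : ∀ x : Fin 2, x = 0 ∨ x = 1 := by decide
      refine DiagIsotropic.of_comp hinj ?_
      rcases h01 (e k) with hk | hk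
      · have hl : e l = 1 := (h01 (e l)).resolve_left (by rw [← hk]; exact hlk)
        refine DiagIsotropic.of_mul_sq (a := 1) (s := s ∘ ![i, j, k, l]) one_ne_zero
          (fun i => hs _) ?_
        convert hσ using 1
        funext t
        fin_cases t <;> simp [h, hij, hjk, hk, hl]
      · have hl : e l = 0 := (h01 (e l)).resolve_right (by rw [← hk]; exact hlk)
        refine DiagIsotropic.of_mul_sq (a := 2⁻¹)
          (s := ![s i, s j, s k, 2 * s l]) (by norm_num)
          (fun t => by fin_cases t <;> simp [hs]) ?_
        convert hσ using 1
        funext t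
        fin_cases t <;> simp [mul_assoc, h, hij, hjk, hk, mul_pow]
        rw [mul_left_comm (c l), h, hl]
        simp
        ring
  · have hcomb : ∀ e : Fin 5 → Fin 2, ∃ i j k : Fin 5, [i, j, k].Nodup ∧ e i = e j ∧ e j = e k := by
      decide
    obtain ⟨i, j, k, hnd, hij, hjk⟩ := hcomb e
    refine scale ![i, j, k] (e k) ?_ ?_
      (by simpa using PadicInt.exists_unit_form_three hp2 (u ∘ ![i, j, k]))
    · have := List.nodup_ofFn (f := ![i, j, k])
      rw [← this]
      simpa [List.ofFn_succ] using hnd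
    · intro t
      fin_cases t <;> simp [hij, hjk]

/-- The ternary form `z² + A x² + B y²` has a nontrivial zero over `K`. -/
def NormFormIsotropic {K : Type*} [Field K] (A B : K) : Prop :=
  ∃ x y z : K, ¬(x = 0 ∧ y = 0 ∧ z = 0) ∧ z ^ 2 + A * x ^ 2 + B * y ^ 2 = 0

namespace NormFormIsotropic

variable {K : Type*} [Field K] {A B B' : K}

theorem symm (h : NormFormIsotropic A B) : NormFormIsotropic B A := by
  obtain ⟨x, y, z, h0, h⟩ := h
  exact ⟨y, x, z, by tauto, by linear_combination h⟩

theorem of_mul_sq {k : K} (hk : k ≠ 0) (h : NormFormIsotropic A (k ^ 2 * B)) :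
    NormFormIsotropic A B := by
  obtain ⟨x, y, z, h0, h⟩ := h
  refine ⟨x, k * y, z, ?_, by linear_combination h⟩
  simpa [hk] using h0

theorem of_mul_eq {t : K} (hB : B ≠ 0) (ht : B * B' = t ^ 2 + A) (h : NormFormIsotropic A B) :
    NormFormIsotropic A B' := by
  obtain ⟨x, y, z, h0, h⟩ := h
  by_cases hy : y = 0
  · exact ⟨x, 0, z, by tauto, by rw [hy] at h; linear_combination h⟩
  · refine ⟨x * t + z, B * y, z * t - A * x, fun hh => mul_ne_zero hB hy hh.2.1, ?_⟩
    linear_combination (t ^ 2 + A) * h + B * y ^ 2 * ht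

theorem of_represents {x y z w : K} (hw : w ≠ 0)
    (h : z ^ 2 + A * x ^ 2 + B * y ^ 2 = -(A * B * w ^ 2)) : NormFormIsotropic A B := by
  by_cases h0 : y ^ 2 + A * w ^ 2 = 0
  · exact ⟨w, 0, y, by tauto, by linear_combination h0⟩
  · refine ⟨z * w + x * y, y ^ 2 + A * w ^ 2, z * y - A * x * w, by tauto, ?_⟩
    linear_combination (y ^ 2 + A * w ^ 2) * h

end NormFormIsotropic

theorem Padic.NormFormIsotropic.exists_primitive {p : ℕ} [Fact p.Prime] {A B : ℤ_[p]}
    (h : NormFormIsotropic (A : ℚ_[p]) (B : ℚ_[p])) :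
    ∃ x y z : ℤ_[p], (x = 1 ∨ y = 1 ∨ z = 1) ∧ z ^ 2 + A * x ^ 2 + B * y ^ 2 = 0 := by
  obtain ⟨x, y, z, h0, h⟩ := h
  let v : Fin 3 → ℚ_[p] := ![x, y, z]
  obtain ⟨i, -, hi⟩ := Finset.exists_max_image Finset.univ (fun i => ‖v i‖) ⟨0, Finset.mem_univ _⟩
  have hvi : v i ≠ 0 := by
    intro hz
    apply h0
    have h1 : ∀ j, v j = 0 := fun j => by
      have := hi j (Finset.mem_univ _)
      rw [hz, norm_zero] at this
      exact norm_le_zero_iff.1 this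
    exact ⟨h1 0, h1 1, h1 2⟩
  have hle : ∀ j, ‖v j / v i‖ ≤ 1 := fun j => by
    rw [norm_div]
    exact div_le_one_of_le₀ (hi j (Finset.mem_univ _)) (norm_nonneg _)
  choose w hw using fun j => show ∃ w : ℤ_[p], (w : ℚ_[p]) = v j / v i from ⟨⟨_, hle j⟩, rfl⟩
  refine ⟨w 0, w 1, w 2, ?_, ?_⟩
  · have : ∀ j, j = i → w j = 1 := by
      rintro j rfl
      exact PadicInt.ext ((hw j).trans (div_self hvi))
    fin_cases i
    · exact Or.inl (this 0 rfl)
    · exact Or.inr (Or.inl (this 1 rfl))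
    · exact Or.inr (Or.inr (this 2 rfl))
  · apply PadicInt.ext
    push_cast [hw]
    have h' : v 2 ^ 2 + A * v 0 ^ 2 + B * v 1 ^ 2 = 0 := h
    field_simp
    linear_combination h'

theorem Padic.not_normFormIsotropic_one_one : ¬ NormFormIsotropic (1 : ℚ_[2]) 1 := by
  intro h
  obtain ⟨x, y, z, h1, h⟩ := Padic.NormFormIsotropic.exists_primitive (A := 1) (B := 1) h
  have key : ∀ x y z : ZMod (2 ^ 2), (x = 1 ∨ y = 1 ∨ z = 1) →
      z ^ 2 + 1 * x ^ 2 + 1 * y ^ 2 ≠ 0 := by decide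
  let φ := PadicInt.toZModPow (p := 2) 2
  refine key (φ x) (φ y) (φ z) ?_ ?_
  · rcases h1 with rfl | rfl | rfl <;> simp
  · rw [← map_zero φ, ← h]
    simp

theorem Padic.NormFormIsotropic.exists_dvd_sq_add {p : ℕ} [hp : Fact p.Prime] {A B : ℕ}
    (hpB : p ∣ B) (hpB2 : ¬ p * p ∣ B)
    (h : NormFormIsotropic (A : ℚ_[p]) (B : ℚ_[p])) : ∃ t : ℤ, (p : ℤ) ∣ t ^ 2 + A := by
  obtain ⟨x, y, z, h1, h⟩ := Padic.NormFormIsotropic.exists_primitive (p := p) (A := (A : ℤ_[p]))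
    (B := (B : ℤ_[p])) (by simpa using h)
  obtain ⟨C, rfl⟩ := hpB
  have hC : ¬ (p : ℤ_[p]) ∣ (C : ℤ_[p]) := by
    intro hd
    apply hpB2
    have := (PadicInt.pow_p_dvd_int_iff (p := p) 1 (C : ℤ)).1 (by simpa using hd)
    rw [pow_one] at this
    exact mul_dvd_mul_left p (by exact_mod_cast this)
  let φ := PadicInt.toZMod (p := p)
  have key : ∀ t : ℤ_[p], φ t = 0 ↔ (p : ℤ_[p]) ∣ t := by
    intro t
    rw [← RingHom.mem_ker, PadicInt.ker_toZMod, PadicInt.maximalIdeal_eq_span_p,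
      Ideal.mem_span_singleton]
  have h2 : φ z ^ 2 + A * φ x ^ 2 = 0 := by
    have := congrArg φ h
    simpa using this
  by_cases hx : φ x = 0
  · exfalso
    have hz : φ z = 0 := by simpa [hx] using h2
    obtain ⟨x, rfl⟩ := (key _).1 hx
    obtain ⟨z, rfl⟩ := (key _).1 hz
    have hpp := PadicInt.prime_p (p := p)
    have hy : (p : ℤ_[p]) ∣ C * y ^ 2 := by
      refine ⟨-(z ^ 2 + A * x ^ 2), ?_⟩
      apply mul_left_cancel₀ hpp.ne_zero
      push_cast at h
      linear_combination h
    have hy' := hpp.dvd_of_dvd_pow ((hpp.dvd_or_dvd hy).resolve_left hC)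
    have hn1 : ∀ t : ℤ_[p], (p : ℤ_[p]) ∣ t → t ≠ 1 := by
      rintro t ht rfl
      exact hpp.not_isUnit (isUnit_of_dvd_one ht)
    rcases h1 with h1 | h1 | h1
    · exact hn1 _ (dvd_mul_right _ _) h1
    · exact hn1 _ hy' h1
    · exact hn1 _ (dvd_mul_right _ _) h1
  · obtain ⟨t, ht⟩ := ZMod.intCast_surjective (φ z / φ x)
    refine ⟨t, ?_⟩
    rw [← ZMod.intCast_zmod_eq_zero_iff_dvd]
    push_cast
    rw [ht]
    field_simp
    linear_combination h2

theorem Squarefree.exists_dvd_sq_add {A : ℤ} (n : ℕ) (hn : Squarefree n)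
    (h : ∀ p : ℕ, p.Prime → p ∣ n → ∃ t : ℤ, (p : ℤ) ∣ t ^ 2 + A) :
    ∃ t : ℤ, (n : ℤ) ∣ t ^ 2 + A := by
  induction n using induction_on_primes with
  | zero => simp at hn
  | one => exact ⟨0, by simp⟩
  | prime_mul p n hp ih =>
    obtain ⟨hpn, -, hn'⟩ := Nat.squarefree_mul_iff.1 hn
    obtain ⟨t, ht⟩ := ih hn' fun q hq hqn => h q hq (hqn.mul_left p)
    obtain ⟨s, hs⟩ := h p hp (dvd_mul_right p n)
    have hco : IsCoprime (p : ℤ) (n : ℤ) := Nat.isCoprime_iff_coprime.2 hpn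
    obtain ⟨a, b, hab⟩ := hco
    refine ⟨s * (b * n) + t * (a * p), ?_⟩
    push_cast
    refine IsCoprime.mul_dvd ⟨a, b, hab⟩ ?_ ?_
    · have : (s * (b * n) + t * (a * p)) ^ 2 + A = (s ^ 2 + A) +
          p * (a * (t - s)) * (2 * s + a * p * (t - s)) := by
        linear_combination (s ^ 2 * (b * n + 1 - a * p) + 2 * s * t * (a * p)) * hab
      rw [this]
      exact dvd_add hs ((dvd_mul_right _ _).mul_right _)
    · have : (s * (b * n) + t * (a * p)) ^ 2 + A = (t ^ 2 + A) +
          n * (b * (s - t)) * (2 * t + b * n * (s - t)) := by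
        linear_combination (t ^ 2 * (a * p + 1 - b * n) + 2 * s * t * (b * n)) * hab
      rw [this]
      exact dvd_add ht ((dvd_mul_right _ _).mul_right _)

/-- A positive-definite form `z² + A x² + B y²` over `ℚ` is anisotropic over some `ℚ_[p]`. -/
theorem exists_padic_not_normFormIsotropic (A B : ℕ) (hA : 0 < A) (hB : 0 < B) :
    ∃ (p : ℕ) (_ : Fact p.Prime), ¬ NormFormIsotropic (A : ℚ_[p]) (B : ℚ_[p]) := by
  induction hn : A + B using Nat.strong_induction_on generalizing A B with
  | _ n ih =>
  subst hn
  wlog hAB : A ≤ B generalizing A B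
  · obtain ⟨p, hp, h⟩ := this B A hB hA
      (fun m hm A' B' hA' hB' h => ih m (by omega) A' B' hA' hB' h) (by omega)
    exact ⟨p, hp, fun h' => h h'.symm⟩
  by_contra! hiso
  by_cases hsq : Squarefree B
  · by_cases hB1 : B = 1
    · have hA1 : A = 1 := by omega
      subst hA1 hB1
      exact Padic.not_normFormIsotropic_one_one (by simpa using hiso 2 ⟨Nat.prime_two⟩)
    obtain ⟨t₀, ht₀⟩ := hsq.exists_dvd_sq_add (A := (A : ℤ)) B fun p hp hpB =>
      have : Fact p.Prime := ⟨hp⟩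
      Padic.NormFormIsotropic.exists_dvd_sq_add hpB
        (fun hd => hp.one_lt.ne' (Nat.isUnit_iff.1 (hsq p hd))) (hiso p ⟨hp⟩)
    have : NeZero B := ⟨hB.ne'⟩
    set t : ℕ := ((t₀ : ZMod B).valMinAbs).natAbs with ht
    have htB : t ≤ B / 2 := ZMod.natAbs_valMinAbs_le _
    have hdvd : B ∣ t ^ 2 + A := by
      zify
      rw [ht, Int.natCast_natAbs, sq_abs, ← ZMod.intCast_zmod_eq_zero_iff_dvd]
      rw [← ZMod.intCast_zmod_eq_zero_iff_dvd] at ht₀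
      push_cast at ht₀ ⊢
      simpa using ht₀
    obtain ⟨B', hB'⟩ := hdvd
    have hB'pos : 0 < B' := by
      rcases Nat.eq_zero_or_pos B' with rfl | h
      · rw [mul_zero] at hB'; omega
      · exact h
    have hlt : B' < B := by
      have h2 : 2 * t ≤ B := by omega
      by_contra! hle
      have : B * B ≤ B * B' := Nat.mul_le_mul_left B hle
      nlinarith [show 2 ≤ B by omega]
    obtain ⟨p, hp, h⟩ := ih (A + B') (by omega) A B' hA hB'pos rfl
    refine h ((hiso p hp).of_mul_eq (t := (t : ℚ_[p])) (by exact_mod_cast hB.ne') ?_)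
    exact_mod_cast hB'.symm
  · rw [Nat.squarefree_iff_prime_squarefree] at hsq
    push Not at hsq
    obtain ⟨q, hq, C, rfl⟩ := hsq
    have hC : 0 < C := Nat.pos_of_mul_pos_left hB
    have hlt : C < q * q * C := by nlinarith [hq.two_le, Nat.mul_le_mul hq.two_le hq.two_le]
    obtain ⟨p, hp, h⟩ := ih (A + C) (by omega) A C hA hC rfl
    refine h (NormFormIsotropic.of_mul_sq (k := (q : ℚ_[p])) (by exact_mod_cast hq.ne_zero) ?_)
    have := hiso p hp
    push_cast at this
    rwa [pow_two]

/-- A quaternary diagonal form over `ℚ_[p]` with nonzero coefficients is universal. -/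
theorem Padic.exists_quaternary_eq {p : ℕ} [Fact p.Prime] {f : Fin 4 → ℚ_[p]} (hf : ∀ i, f i ≠ 0)
    (d : ℚ_[p]) : ∃ x : Fin 4 → ℚ_[p], ∑ i, f i * x i ^ 2 = d := by
  obtain ⟨x, hx, h⟩ := Padic.diagIsotropic_five (Fin.cons (-d) f)
  rw [Fin.sum_univ_succ] at h
  simp only [Fin.cons_zero, Fin.cons_succ] at h
  by_cases h0 : x 0 = 0
  · have hs : ∑ i, f i * x i.succ ^ 2 = 0 := by simpa [h0] using h
    obtain ⟨i, hi⟩ : ∃ i : Fin 4, x i.succ ≠ 0 := by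
      by_contra! hall
      exact hx (funext (Fin.cases h0 hall))
    have hfi := hf i
    set r := (d - f i) / (2 * f i * x i.succ) with hr
    refine ⟨fun j => r * x j.succ + (Pi.single i 1 : Fin 4 → ℚ_[p]) j, ?_⟩
    have e : ∀ j, f j * (r * x j.succ + (Pi.single i 1 : Fin 4 → ℚ_[p]) j) ^ 2 =
        r ^ 2 * (f j * x j.succ ^ 2) +
          (Pi.single i (2 * r * f i * x i.succ + f i) : Fin 4 → ℚ_[p]) j := by
      intro j
      rcases eq_or_ne j i with rfl | hj
      · simp
        ring
      · simp [hj]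
        ring
    simp only [e]
    rw [Finset.sum_add_distrib, ← Finset.mul_sum, hs, Fintype.sum_pi_single', hr]
    field_simp
    ring
  · refine ⟨fun i => x i.succ / x 0, ?_⟩
    have : ∑ i, f i * (x i.succ / x 0) ^ 2 = (∑ i, f i * x i.succ ^ 2) / x 0 ^ 2 := by
      rw [Finset.sum_div]
      exact Finset.sum_congr rfl fun i _ => by rw [div_pow, mul_div_assoc]
    rw [this, div_eq_iff (pow_ne_zero 2 h0)]
    linear_combination h

theorem Padic.denseRange_ratCast_pi (p : ℕ) [Fact p.Prime] (ι : Type*) :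
    DenseRange fun (x : ι → ℚ) (i : ι) => ((x i : ℚ) : ℚ_[p]) := by
  have h : DenseRange ((↑) : ℚ → ℚ_[p]) := by
    rw [Metric.denseRange_iff]
    intro x r hr
    obtain ⟨q, hq⟩ := Padic.rat_dense p x hr
    exact ⟨q, by rwa [dist_eq_norm]⟩
  exact DenseRange.piMap fun _ => h

theorem Padic.setOf_mul_sq_mem_nhds {p : ℕ} [Fact p.Prime] {d : ℚ_[p]} (hd : d ≠ 0) :
    {t : ℚ_[p] | ∃ w : ℚ_[p], w ≠ 0 ∧ d * w ^ 2 = t} ∈ nhds d := by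
  have h : HasStrictDerivAt (fun w : ℚ_[p] => d * w ^ 2) (d * (2 * 1)) 1 := by
    simpa using (hasStrictDerivAt_pow 2 (1 : ℚ_[p])).const_mul d
  have h2 := h.map_nhds_eq (by simpa using hd)
  simp only [one_pow, mul_one] at h2
  rw [← h2]
  exact Filter.image_mem_map (isOpen_ne.mem_nhds one_ne_zero)

theorem exists_quaternary_ne_normForm {p : ℕ} [Fact p.Prime] {A B : ℕ} (hA : A ≠ 0) (hB : B ≠ 0)
    (h : ¬ NormFormIsotropic (A : ℚ_[p]) (B : ℚ_[p])) {f : Fin 4 → ℚ} (hf : ∀ i, f i ≠ 0) :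
    ∃ x : Fin 4 → ℚ, ∀ a b c : ℚ, ∑ i, f i * x i ^ 2 ≠ a ^ 2 + A * b ^ 2 + B * c ^ 2 := by
  have hd : -((A : ℚ_[p]) * B) ≠ 0 :=
    neg_ne_zero.2 (mul_ne_zero (by exact_mod_cast hA) (by exact_mod_cast hB))
  obtain ⟨x₀, hx₀⟩ := Padic.exists_quaternary_eq (p := p) (f := fun i => (f i : ℚ_[p]))
    (fun i => by exact_mod_cast hf i) (-((A : ℚ_[p]) * B))
  have hcont : Continuous fun x : Fin 4 → ℚ_[p] => ∑ i, (f i : ℚ_[p]) * x i ^ 2 := by fun_prop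
  have hmem := hcont.continuousAt.preimage_mem_nhds
    (by rw [hx₀]; exact Padic.setOf_mul_sq_mem_nhds hd : _ ∈ nhds _)
  obtain ⟨_, ⟨x, rfl⟩, w, hw, hwx⟩ :=
    (Padic.denseRange_ratCast_pi p (Fin 4)).inter_nhds_nonempty hmem
  refine ⟨x, fun a b c habc => h ?_⟩
  refine NormFormIsotropic.of_represents (x := (b : ℚ_[p])) (y := (c : ℚ_[p])) (z := (a : ℚ_[p]))
    hw ?_
  have := congrArg (fun t : ℚ => (t : ℚ_[p])) habc
  push_cast at this
  rw [← this]
  linear_combination -hwx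

theorem exists_mul_sq_eq_natCast {q : ℚ} (hq : 0 < q) : ∃ n d : ℕ, n ≠ 0 ∧ d ≠ 0 ∧
    q * (d : ℚ) ^ 2 = n := by
  have hnum : 0 < q.num := Rat.num_pos.2 hq
  refine ⟨q.num.toNat * q.den, q.den, ?_, q.den_nz, ?_⟩
  · exact mul_ne_zero (by omega) q.den_nz
  · have h1 : ((q.num.toNat : ℕ) : ℚ) = q.num := by
      exact_mod_cast congrArg (fun z : ℤ => (z : ℚ)) (Int.toNat_of_nonneg hnum.le)
    push_cast
    rw [h1, pow_two, ← mul_assoc, Rat.mul_den_eq_num]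

/-- A quaternary diagonal form over `ℚ` with nonzero coefficients takes a value that is not taken
by a given positive-definite ternary diagonal form. -/
theorem exists_quaternary_ne_ternary {f : Fin 4 → ℚ} {g : Fin 3 → ℚ} (hf : ∀ i, f i ≠ 0)
    (hg : ∀ i, 0 < g i) :
    ∃ x : Fin 4 → ℚ, ∀ y : Fin 3 → ℚ, ∑ i, f i * x i ^ 2 ≠ ∑ i, g i * y i ^ 2 := by
  obtain ⟨A, s, hA, hs, hAs⟩ := exists_mul_sq_eq_natCast (mul_pos (hg 0) (hg 1))
  obtain ⟨B, t, hB, ht, hBt⟩ := exists_mul_sq_eq_natCast (mul_pos (hg 0) (hg 2))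
  obtain ⟨p, hp, h⟩ := exists_padic_not_normFormIsotropic A B (Nat.pos_of_ne_zero hA)
    (Nat.pos_of_ne_zero hB)
  obtain ⟨x, hx⟩ := exists_quaternary_ne_normForm hA hB h (f := fun i => g 0 * f i)
    fun i => mul_ne_zero (hg 0).ne' (hf i)
  refine ⟨x, fun y hy => hx (g 0 * y 0) (y 1 / s) (y 2 / t) ?_⟩
  have hs' : (s : ℚ) ≠ 0 := by exact_mod_cast hs
  have ht' : (t : ℚ) ≠ 0 := by exact_mod_cast ht
  simp only [mul_assoc]
  rw [← Finset.mul_sum, hy, ← hAs, ← hBt, Fin.sum_univ_three]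
  field_simp

theorem QuadraticForm.exists_diagonal {V : Type*} [AddCommGroup V] [Module ℚ V]
    [FiniteDimensional ℚ V] {n : ℕ} (hn : Module.finrank ℚ V = n) (Q : QuadraticForm ℚ V) :
    ∃ (w : Fin n → ℚ) (e : V ≃ₗ[ℚ] (Fin n → ℚ)), ∀ x, Q x = ∑ i, w i * e x i ^ 2 := by
  subst hn
  obtain ⟨w, ⟨e⟩⟩ := Q.equivalent_weightedSumSquares
  refine ⟨w, e.toLinearEquiv, fun x => ?_⟩
  rw [← e.map_app x, QuadraticMap.weightedSumSquares_apply]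
  exact Finset.sum_congr rfl fun i _ => by simp [pow_two]

theorem exists_diagonal_ne_diagonal {n : ℕ} (h1 : 1 ≤ n) (h4 : n < 4) {f : Fin (n + 1) → ℚ}
    {g : Fin n → ℚ} (hf : ∀ i, f i ≠ 0) (hg : ∀ i, 0 < g i) :
    ∃ x : Fin (n + 1) → ℚ, ∀ y : Fin n → ℚ, ∑ i, f i * x i ^ 2 ≠ ∑ i, g i * y i ^ 2 := by
  interval_cases n
  · obtain ⟨x, hx⟩ := exists_quaternary_ne_ternary (f := ![f 0, f 1, 1, 1]) (g := ![g 0, 1, 1])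
      (by intro i; fin_cases i <;> simp [hf]) (by intro i; fin_cases i <;> simp [hg])
    refine ⟨![x 0, x 1], fun y hy => hx ![y 0, x 2, x 3] ?_⟩
    simp [Fin.sum_univ_succ] at hy ⊢
    linear_combination hy
  · obtain ⟨x, hx⟩ := exists_quaternary_ne_ternary (f := ![f 0, f 1, f 2, 1]) (g := ![g 0, g 1, 1])
      (by intro i; fin_cases i <;> simp [hf]) (by intro i; fin_cases i <;> simp [hg])
    refine ⟨![x 0, x 1, x 2], fun y hy => hx ![y 0, y 1, x 3] ?_⟩
    simp [Fin.sum_univ_succ] at hy ⊢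
    linear_combination hy
  · exact exists_quaternary_ne_ternary hf hg

theorem QuadraticForm.exists_ne_of_posDef {N n : ℕ} (h1 : 1 ≤ n) (h4 : n < 4) (hN : n < N)
    (Q : QuadraticForm ℚ (Fin N → ℚ)) (P : QuadraticForm ℚ (Fin n → ℚ)) (hP : P.PosDef) :
    ∃ x, x ≠ 0 ∧ ∀ y, y ≠ 0 → Q x ≠ P y := by
  by_contra! h
  obtain ⟨w, e, hQ⟩ := QuadraticForm.exists_diagonal (n := N) (by simp) Q
  obtain ⟨v, d, hP'⟩ := QuadraticForm.exists_diagonal (n := n) (by simp) P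
  have hdiag : ∀ x : Fin N → ℚ, x ≠ 0 → ∃ y : Fin n → ℚ, y ≠ 0 ∧
      ∑ i, w i * x i ^ 2 = ∑ i, v i * y i ^ 2 := by
    intro x hx
    obtain ⟨y, hy, hxy⟩ := h (e.symm x) (by simpa using hx)
    refine ⟨d y, by simpa using hy, ?_⟩
    rw [← hP', ← hxy, hQ]
    simp
  have hpos : ∀ y : Fin n → ℚ, y ≠ 0 → 0 < ∑ i, v i * y i ^ 2 := by
    intro y hy
    have := hP (d.symm y) (by simpa using hy)
    rw [hP'] at this
    simpa using this
  have hv : ∀ i, 0 < v i := fun i => by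
    have := hpos (Pi.single i 1) (by simp)
    rwa [Finset.sum_eq_single i (fun j _ hj => by simp [hj]) (by simp), Pi.single_eq_same, one_pow,
      mul_one] at this
  have hw : ∀ i, w i ≠ 0 := fun i => by
    obtain ⟨y, hy, hxy⟩ := hdiag (Pi.single i 1) (by simp)
    have := hpos y hy
    rw [← hxy, Finset.sum_eq_single i (fun j _ hj => by simp [hj]) (by simp), Pi.single_eq_same,
      one_pow, mul_one] at this
    exact this.ne'
  have hinj : Function.Injective (Fin.castLE (n := n + 1) (m := N) hN) := Fin.castLE_injective hN
  obtain ⟨x, hx⟩ := exists_diagonal_ne_diagonal h1 h4 (f := w ∘ Fin.castLE hN)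
    (fun i => hw _) hv
  have hx0 : x ≠ 0 := by
    rintro rfl
    exact hx 0 (by simp)
  obtain ⟨y, -, hy⟩ := hdiag (Function.extend (Fin.castLE hN) x 0) (by
    intro h0
    refine hx0 (funext fun i => ?_)
    have := congrFun h0 (Fin.castLE hN i)
    rwa [hinj.extend_apply] at this)
  refine hx y ?_
  rw [← hy]
  refine Fintype.sum_of_injective _ hinj _ _ ?_ ?_
  · intro i hi
    rw [Function.extend_apply' _ _ _ hi]
    simp
  · intro i
    simp [hinj.extend_apply]

/-- On finitely many reals, the identity is approximated by `ℚ`-linear maps `ℝ → ℚ`. -/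
theorem exists_ratLinearMap_approx {ι : Type*} [Finite ι] (T : ι → ℝ) {ε : ℝ} (hε : 0 < ε) :
    ∃ φ : ℝ →ₗ[ℚ] ℚ, ∀ i, |(φ (T i) : ℝ) - T i| < ε := by
  let b := Module.Basis.ofVectorSpace ℚ ℝ
  let F : (Module.Basis.ofVectorSpaceIndex ℚ ℝ → ℝ) → ι → ℝ := fun r i =>
    ∑ k ∈ (b.repr (T i)).support, (b.repr (T i) k : ℝ) * r k
  have hF : Continuous F := by fun_prop
  have hrepr : F b = T := by
    funext i
    conv_rhs => rw [← b.linearCombination_repr (T i), Finsupp.linearCombination_apply]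
    simp only [F, Finsupp.sum, Rat.smul_def]
  have hd : DenseRange fun (x : Module.Basis.ofVectorSpaceIndex ℚ ℝ → ℚ) k => ((x k : ℚ) : ℝ) :=
    DenseRange.piMap fun _ => Rat.denseRange_cast
  have := Fintype.ofFinite ι
  have hmem := hF.continuousAt.preimage_mem_nhds
    (by rw [hrepr]; exact Metric.ball_mem_nhds T hε : Metric.ball T ε ∈ nhds (F b))
  obtain ⟨_, ⟨r, rfl⟩, hr⟩ := hd.inter_nhds_nonempty hmem
  refine ⟨b.constr ℚ r, fun i => ?_⟩
  have h1 : ((b.constr ℚ r (T i) : ℚ) : ℝ) = F (fun k => (r k : ℝ)) i := by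
    rw [Module.Basis.constr_apply]
    simp [F, Finsupp.sum]
  rw [h1, ← Real.dist_eq]
  exact (dist_pi_lt_iff hε).1 hr i

theorem Matrix.PosDef.exists_mul_norm_sq_le {n : ℕ} {S : Matrix (Fin n) (Fin n) ℝ}
    (hS : S.PosDef) : ∃ m : ℝ, 0 < m ∧ ∀ y : Fin n → ℝ, m * ‖y‖ ^ 2 ≤ y ⬝ᵥ (S *ᵥ y) := by
  rcases (Metric.sphere (0 : Fin n → ℝ) 1).eq_empty_or_nonempty with he | hne
  · refine ⟨1, one_pos, fun y => ?_⟩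
    have hy : y = 0 := by
      by_contra hy
      have : (‖y‖⁻¹ • y) ∈ Metric.sphere (0 : Fin n → ℝ) 1 := by
        simp [norm_smul, hy]
      rw [he] at this
      exact this
    simp [hy]
  have hcont : Continuous fun y : Fin n → ℝ => y ⬝ᵥ (S *ᵥ y) := by
    simp only [dotProduct, mulVec]
    fun_prop
  obtain ⟨z, hz, hmin⟩ := (isCompact_sphere (0 : Fin n → ℝ) 1).exists_isMinOn hne
    hcont.continuousOn
  have hz0 : z ≠ 0 := by
    rintro rfl
    simp at hz
  refine ⟨z ⬝ᵥ (S *ᵥ z), by simpa using hS.dotProduct_mulVec_pos hz0, fun y => ?_⟩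
  by_cases hy : y = 0
  · simp [hy]
  have hmem : (‖y‖⁻¹ • y) ∈ Metric.sphere (0 : Fin n → ℝ) 1 := by
    simp [norm_smul, hy]
  have h := isMinOn_iff.1 hmin _ hmem
  have hy' : 0 < ‖y‖ := norm_pos_iff.2 hy
  rw [mulVec_smul, smul_dotProduct, dotProduct_smul, smul_eq_mul, smul_eq_mul, ← mul_assoc,
    ← mul_inv, inv_mul_eq_div, le_div_iff₀ (by positivity)] at h
  rwa [pow_two]

theorem map_dotProduct_mulVec {n : ℕ} (φ : ℝ →ₗ[ℚ] ℚ) (S : Matrix (Fin n) (Fin n) ℝ)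
    (x : Fin n → ℚ) : φ ((fun i => (x i : ℝ)) ⬝ᵥ (S *ᵥ fun i => (x i : ℝ))) =
      (S.map φ).toQuadraticForm' x := by
  have h : ∀ (q : ℚ) (r : ℝ), φ ((q : ℝ) * r) = q * φ r := fun q r => by
    rw [← Rat.smul_def, map_smul, smul_eq_mul]
  simp only [dotProduct, mulVec, Matrix.toQuadraticForm', LinearMap.BilinMap.toQuadraticMap_apply,
    Matrix.toLinearMap₂'_apply, map_sum, h, Matrix.map_apply, smul_eq_mul]
  refine Finset.sum_congr rfl fun i _ => ?_
  rw [Finset.mul_sum]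
  refine Finset.sum_congr rfl fun j _ => ?_
  rw [mul_comm (S i j), h]

/-- A real positive-definite form specializes to a rational positive-definite one along some
`ℚ`-linear map `ℝ → ℚ`. -/
theorem Matrix.PosDef.exists_ratLinearMap_posDef {n : ℕ} {S : Matrix (Fin n) (Fin n) ℝ}
    (hS : S.PosDef) : ∃ φ : ℝ →ₗ[ℚ] ℚ, (S.map φ).toQuadraticForm'.PosDef := by
  obtain ⟨m, hm, hle⟩ := hS.exists_mul_norm_sq_le
  obtain ⟨φ, hφ⟩ := exists_ratLinearMap_approx (fun ij : Fin n × Fin n => S ij.1 ij.2)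
    (ε := m / (n ^ 2 + 1)) (by positivity)
  refine ⟨φ, fun y hy => ?_⟩
  set y' : Fin n → ℝ := fun i => (y i : ℝ) with hy'
  have hpos : 0 < ‖y'‖ := by
    rw [norm_pos_iff]
    intro h0
    exact hy (funext fun i => by simpa [hy'] using congrFun h0 i)
  have hdiff : (((S.map φ).toQuadraticForm' y : ℚ) : ℝ) - y' ⬝ᵥ (S *ᵥ y') =
      ∑ i, ∑ j, y' i * y' j * ((φ (S i j) : ℝ) - S i j) := by
    simp only [dotProduct, mulVec, Matrix.toQuadraticForm',
      LinearMap.BilinMap.toQuadraticMap_apply, Matrix.toLinearMap₂'_apply, Matrix.map_apply,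
      smul_eq_mul, Finset.mul_sum]
    push_cast
    rw [← Finset.sum_sub_distrib]
    refine Finset.sum_congr rfl fun i _ => ?_
    rw [← Finset.sum_sub_distrib]
    exact Finset.sum_congr rfl fun j _ => by ring
  have hbound : |∑ i, ∑ j, y' i * y' j * ((φ (S i j) : ℝ) - S i j)| ≤
      n ^ 2 * (‖y'‖ ^ 2 * (m / (n ^ 2 + 1))) := by
    calc _ ≤ ∑ i, ∑ j, |y' i * y' j * ((φ (S i j) : ℝ) - S i j)| :=
          (Finset.abs_sum_le_sum_abs _ _).trans
            (Finset.sum_le_sum fun i _ => Finset.abs_sum_le_sum_abs _ _)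
      _ ≤ ∑ i : Fin n, ∑ j : Fin n, ‖y'‖ ^ 2 * (m / (n ^ 2 + 1)) := by
          refine Finset.sum_le_sum fun i _ => Finset.sum_le_sum fun j _ => ?_
          rw [abs_mul, abs_mul, pow_two]
          have h1 : |y' i| ≤ ‖y'‖ := norm_le_pi_norm y' i
          have h2 : |y' j| ≤ ‖y'‖ := norm_le_pi_norm y' j
          have h3 := (hφ (i, j)).le
          gcongr
      _ = _ := by
          simp
          ring
  have hlt : (n : ℝ) ^ 2 * (‖y'‖ ^ 2 * (m / (n ^ 2 + 1))) < m * ‖y'‖ ^ 2 := by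
    rw [show (n : ℝ) ^ 2 * (‖y'‖ ^ 2 * (m / (n ^ 2 + 1))) =
      (m * ‖y'‖ ^ 2) * (n ^ 2 / (n ^ 2 + 1)) by ring]
    refine mul_lt_of_lt_one_right (by positivity) ?_
    rw [div_lt_one (by positivity)]
    linarith
  have h1 := hle y'
  have h2 := (abs_le.1 (hdiff ▸ hbound)).1
  have h3 : (0 : ℝ) < (((S.map φ).toQuadraticForm' y : ℚ) : ℝ) := by linarith
  exact_mod_cast h3


theorem stmt_11 (N N₂ : ℕ) (h₁ : 1 ≤ N₂) (h₂ : N₂ < min 4 N)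
    (S : Matrix (Fin N) (Fin N) ℝ) (S₂ : Matrix (Fin N₂) (Fin N₂) ℝ)
    (hS : S.PosDef) (hS₂ : S₂.PosDef) :
    ¬ ({r : ℝ | ∃ x : Fin N → ℚ, x ≠ 0 ∧
          (fun i => (x i : ℝ)) ⬝ᵥ (S *ᵥ fun i => (x i : ℝ)) = r} ⊆
        {r : ℝ | ∃ y : Fin N₂ → ℚ, y ≠ 0 ∧
          (fun i => (y i : ℝ)) ⬝ᵥ (S₂ *ᵥ fun i => (y i : ℝ)) = r}) ∧
    ¬ ({r : ℝ | ∃ x : Fin N → ℤ, x ≠ 0 ∧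
          (fun i => (x i : ℝ)) ⬝ᵥ (S *ᵥ fun i => (x i : ℝ)) = r} ⊆
        {r : ℝ | ∃ y : Fin N₂ → ℤ, y ≠ 0 ∧
          (fun i => (y i : ℝ)) ⬝ᵥ (S₂ *ᵥ fun i => (y i : ℝ)) = r}) := by
  have hrat : ¬ ({r : ℝ | ∃ x : Fin N → ℚ, x ≠ 0 ∧
          (fun i => (x i : ℝ)) ⬝ᵥ (S *ᵥ fun i => (x i : ℝ)) = r} ⊆
        {r : ℝ | ∃ y : Fin N₂ → ℚ, y ≠ 0 ∧
          (fun i => (y i : ℝ)) ⬝ᵥ (S₂ *ᵥ fun i => (y i : ℝ)) = r}) := by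
    intro hsub
    obtain ⟨φ, hφ⟩ := hS₂.exists_ratLinearMap_posDef
    obtain ⟨x, hx, hne⟩ := QuadraticForm.exists_ne_of_posDef h₁
      (h₂.trans_le (min_le_left _ _)) (h₂.trans_le (min_le_right _ _))
      (S.map φ).toQuadraticForm' _ hφ
    obtain ⟨y, hy, hxy⟩ := hsub ⟨x, hx, rfl⟩
    refine hne y hy ?_
    rw [← map_dotProduct_mulVec, ← map_dotProduct_mulVec, hxy]
  refine ⟨hrat, fun hsub => hrat ?_⟩
  rintro _ ⟨x, hx, rfl⟩
  obtain ⟨⟨m, hm⟩, hmx⟩ := IsLocalization.exist_integer_multiples_of_finite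
    (nonZeroDivisors ℤ) x
  choose z hz using hmx
  have hm0 : (m : ℝ) ≠ 0 := by exact_mod_cast nonZeroDivisors.ne_zero hm
  have hzx : ∀ i, (z i : ℝ) = m * (x i : ℝ) := by
    intro i
    have := hz i
    simp only [eq_intCast, Algebra.smul_def] at this
    exact_mod_cast congrArg (fun q : ℚ => (q : ℝ)) this
  have hz0 : z ≠ 0 := by
    rintro rfl
    refine hx (funext fun i => ?_)
    have := hzx i
    simpa [hm0] using this
  obtain ⟨y, hy, hxy⟩ := hsub ⟨z, hz0, rfl⟩
  refine ⟨fun i => (y i : ℚ) / m, fun h0 => hy (funext fun i => ?_), ?_⟩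
  · have hm1 : (m : ℚ) ≠ 0 := by exact_mod_cast nonZeroDivisors.ne_zero hm
    simpa [hm1] using congrFun h0 i
  · have e1 : (fun i => (((y i : ℚ) / m : ℚ) : ℝ)) = (m : ℝ)⁻¹ • fun i => (y i : ℝ) := by
      funext i
      simp [div_eq_inv_mul]
    have e2 : (fun i => (x i : ℝ)) = (m : ℝ)⁻¹ • fun i => (z i : ℝ) := by
      funext i
      simp [hzx, hm0]
    rw [e1, e2]
    simp only [mulVec_smul, smul_dotProduct, dotProduct_smul]
    rw [hxy]
end

section
/- Let S₁, …, S_m be positive-definite real symmetric matrices, where Sᵢ has size Nᵢ×Nᵢ. Then there exist a positive integer s, real numbers λ₁, …, λ_s that are linearly independent over ℚ, and positive-definite rational symmetric Nᵢ×Nᵢ matrices T_{ij} (for 1 ≤ i ≤ m, 1 ≤ j ≤ s) such that Sᵢ = Σ_{j=1}^{s} λⱼ·T_{ij} for every i (entrywise, with the rational matrices viewed inside ℝ). -/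
open Matrix

open scoped Topology

/-- Positive definiteness is an open condition along a continuous family of symmetric matrices. -/
theorem eventually_posDef_of_continuous {X n : Type*} [TopologicalSpace X] [Fintype n]
    {A : X → Matrix n n ℝ} (hA : Continuous A) (hsymm : ∀ x, (A x).IsSymm) {x₀ : X}
    (h₀ : (A x₀).PosDef) : ∀ᶠ x in 𝓝 x₀, (A x).PosDef := by
  have hpos : ∀ᶠ x in 𝓝 x₀, ∀ v ∈ Metric.sphere (0 : n → ℝ) 1, 0 < v ⬝ᵥ (A x *ᵥ v) := by
    refine (isCompact_sphere (0 : n → ℝ) 1).eventually_forall_of_forall_eventually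
      (P := fun x v ↦ 0 < v ⬝ᵥ (A x *ᵥ v)) fun v hv ↦ ?_
    have hcont : Continuous fun z : X × (n → ℝ) ↦ z.2 ⬝ᵥ (A z.1 *ᵥ z.2) :=
      continuous_snd.dotProduct ((hA.comp continuous_fst).matrix_mulVec continuous_snd)
    refine hcont.continuousAt.eventually_const_lt ?_
    have hv0 : v ≠ 0 := by
      rintro rfl
      simp at hv
    simpa using h₀.dotProduct_mulVec_pos hv0
  filter_upwards [hpos] with x hx
  refine .of_dotProduct_mulVec_pos (.ext fun i j ↦ (hsymm x).apply i j) fun v hv ↦ ?_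
  have hv' : 0 < ‖v‖ := norm_pos_iff.mpr hv
  have h := hx (‖v‖⁻¹ • v) (by simp [norm_smul, hv'.ne'])
  rw [mulVec_smul, smul_dotProduct, dotProduct_smul, smul_eq_mul, smul_eq_mul,
    mul_pos_iff_of_pos_left (by positivity), mul_pos_iff_of_pos_left (by positivity)] at h
  simpa using h

/-- The rational points of a neighbourhood in `ℝ^ι` span `ℚ^ι`. -/
theorem span_rat_points_eq_top_of_mem_nhds {ι : Type*} [Finite ι] {x : ι → ℝ} {U : Set (ι → ℝ)}
    (hU : U ∈ 𝓝 x) :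
    Submodule.span ℚ {q : ι → ℚ | (fun i ↦ (q i : ℝ)) ∈ U} = ⊤ := by
  classical
  have hdense : DenseRange fun (q : ι → ℚ) i ↦ (q i : ℝ) :=
    DenseRange.piMap fun _ ↦ Rat.denseRange_cast
  obtain ⟨q, hq⟩ := hdense.exists_mem_open isOpen_interior ⟨x, mem_interior_iff_mem_nhds.mpr hU⟩
  rw [eq_top_iff, ← (Pi.basisFun ℚ ι).span_eq, Submodule.span_le]
  rintro _ ⟨k, rfl⟩
  have hcont : Continuous fun (t : ℚ) i ↦ ((q + t • Pi.basisFun ℚ ι k) i : ℝ) := by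
    refine continuous_pi fun i ↦ Rat.continuous_coe_real.comp ?_
    simp only [Pi.add_apply, Pi.smul_apply]
    fun_prop
  have hev : ∀ᶠ t in 𝓝 (0 : ℚ), (fun i ↦ ((q + t • Pi.basisFun ℚ ι k) i : ℝ)) ∈ U :=
    hcont.continuousAt.eventually_mem (by simpa using mem_interior_iff_mem_nhds.mp hq)
  obtain ⟨t, htU, ht⟩ :=
    ((hev.filter_mono nhdsWithin_le_nhds).and (self_mem_nhdsWithin (s := {(0 : ℚ)}ᶜ))).exists
  have hsub := Submodule.sub_mem _ (Submodule.subset_span (R := ℚ)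
    (s := {q : ι → ℚ | (fun i ↦ (q i : ℝ)) ∈ U}) htU) (Submodule.subset_span (interior_subset (s := U) hq))
  rw [add_sub_cancel_left] at hsub
  exact (Submodule.smul_mem_iff _ ht).mp hsub

/-- A vector with `ℚ`-linearly independent coordinates is a combination, with `ℚ`-linearly
independent coefficients, of rational vectors chosen from any prescribed neighbourhood of it. -/
theorem exists_linearIndependent_eq_sum_rat_mem_nhds {s : ℕ} {β : Fin s → ℝ}
    (hβ : LinearIndependent ℚ β) {U : Set (Fin s → ℝ)} (hU : U ∈ 𝓝 β) :
    ∃ (lam : Fin s → ℝ) (c : Fin s → Fin s → ℚ), LinearIndependent ℚ lam ∧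
      (∀ k, (fun l ↦ (c k l : ℝ)) ∈ U) ∧ ∀ l, β l = ∑ k, lam k * c k l := by
  have hex := Submodule.exists_fun_fin_finrank_span_eq ℚ
    {q : Fin s → ℚ | (fun i ↦ (q i : ℝ)) ∈ U}
  rw [span_rat_points_eq_top_of_mem_nhds hU, finrank_top, Module.finrank_fin_fun] at hex
  obtain ⟨c, hcU, hspan, hc⟩ := hex
  let b : Module.Basis (Fin s) ℚ (Fin s → ℚ) := .mk hc hspan.ge
  let d (l k : Fin s) : ℚ := b.repr (Pi.single l 1) k
  have hd (j l : Fin s) : ∑ k, d j k * c k l = if l = j then 1 else 0 := by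
    have h := congrFun (b.sum_repr (Pi.single j 1)) l
    simpa [b, d, Finset.sum_apply, Pi.single_apply] using h
  let lam (k : Fin s) : ℝ := ∑ j, β j * d j k
  have hsum (l : Fin s) : β l = ∑ k, lam k * c k l := by
    have hd' (j : Fin s) : ∑ k, (d j k : ℝ) * c k l = if l = j then 1 else 0 := by
      have h := hd j l
      split_ifs at h ⊢ <;> exact_mod_cast h
    simp only [lam, Finset.sum_mul]
    rw [Finset.sum_comm]
    simp [mul_assoc, ← Finset.mul_sum, hd']
  refine ⟨lam, c, ?_, hcU, hsum⟩
  rw [linearIndependent_iff_card_le_finrank_span]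
  refine (linearIndependent_iff_card_le_finrank_span.mp hβ).trans ?_
  have := FiniteDimensional.span_of_finite ℚ (Set.finite_range lam)
  refine Submodule.finrank_mono (Submodule.span_le.mpr ?_)
  rintro _ ⟨l, rfl⟩
  rw [hsum l]
  refine Submodule.sum_mem _ fun k _ ↦ ?_
  rw [mul_comm, ← Rat.smul_def]
  exact Submodule.smul_mem _ _ (Submodule.subset_span ⟨k, rfl⟩)

theorem stmt_12 (m : ℕ) (N : Fin m → ℕ)
    (S : ∀ i : Fin m, Matrix (Fin (N i)) (Fin (N i)) ℝ)
    (hS : ∀ i, (S i).PosDef) :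
    ∃ (s : ℕ) (_ : 0 < s) (lam : Fin s → ℝ),
      LinearIndependent ℚ lam ∧
      ∃ T : ∀ i : Fin m, Fin s → Matrix (Fin (N i)) (Fin (N i)) ℚ,
        (∀ i j, (T i j).IsSymm) ∧
        (∀ i j, ((T i j).map (fun q : ℚ => (q : ℝ))).PosDef) ∧
        ∀ i, S i = ∑ j, lam j • (T i j).map (fun q : ℚ => (q : ℝ)) := by
  -- Adjoining `1` to the entries keeps their span nonzero even if there are no entries.
  let E : Set ℝ := insert 1 (⋃ i, Set.range fun p : Fin (N i) × Fin (N i) ↦ S i p.1 p.2)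
  have hE : E.Finite := (Set.finite_iUnion fun i ↦ Set.finite_range _).insert 1
  have hSE (i p r) : S i p r ∈ E := .inr (Set.mem_iUnion.mpr ⟨i, (p, r), rfl⟩)
  have := FiniteDimensional.span_of_finite ℚ hE
  obtain ⟨β, -, hspan, hβ⟩ := Submodule.exists_fun_fin_finrank_span_eq ℚ E
  generalize Module.finrank ℚ (Submodule.span ℚ E) = s at β
  have hcoord (e : ℝ) : ∃ a : Fin s → ℚ, e ∈ E → ∑ j, a j • β j = e := by
    by_cases he : e ∈ E
    · have h : e ∈ Submodule.span ℚ E := Submodule.subset_span he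
      rw [← hspan, Submodule.mem_span_range_iff_exists_fun] at h
      exact h.imp fun _ ha _ ↦ ha
    · exact ⟨0, fun h ↦ absurd h he⟩
  choose a ha using hcoord
  have hs0 : 0 < s := by
    rw [Nat.pos_iff_ne_zero]
    rintro rfl
    simpa using ha 1 (.inl rfl)
  let A (i : Fin m) (x : Fin s → ℝ) : Matrix (Fin (N i)) (Fin (N i)) ℝ :=
    .of fun p r ↦ ∑ j, x j * a (S i p r) j
  have hSsymm (i p r) : S i p r = S i r p := by simpa using (hS i).1.apply r p
  have hAβ (i) : A i β = S i := by
    ext p r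
    simpa [A, Rat.smul_def, mul_comm] using ha _ (hSE i p r)
  have hU : ∀ᶠ x in 𝓝 β, ∀ i, (A i x).PosDef := by
    refine Filter.eventually_all.mpr fun i ↦ eventually_posDef_of_continuous ?_ (fun x ↦ ?_)
      (by simpa only [hAβ] using hS i)
    · exact continuous_matrix fun p r ↦ by simp only [A, of_apply]; fun_prop
    · ext p r
      simp [A, hSsymm i p r]
  obtain ⟨lam, c, hlam, hc, hsum⟩ := exists_linearIndependent_eq_sum_rat_mem_nhds hβ hU
  have hmap (i k) : (of fun p r ↦ ∑ j, c k j * a (S i p r) j).map (fun q : ℚ => (q : ℝ)) =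
      A i fun l ↦ c k l := by
    ext p r
    simp [A]
  refine ⟨s, hs0, lam, hlam, fun i k ↦ of fun p r ↦ ∑ j, c k j * a (S i p r) j,
    fun i k ↦ ?_, fun i k ↦ ?_, fun i ↦ ?_⟩
  · ext p r
    simp [hSsymm i p r]
  · rw [hmap]
    exact hc k i
  · simp only [hmap]
    rw [← hAβ i]
    ext p r
    simp only [A, of_apply, Matrix.sum_apply, Matrix.smul_apply, smul_eq_mul]
    simp only [hsum, Finset.sum_mul, Finset.mul_sum, mul_assoc]
    exact Finset.sum_comm
end

section
/- Let N and N₂ be positive integers with 1 ≤ N₂ < min{4, N}. Let S be a rational symmetric N×N matrix with det S ≠ 0 (a non-singular N-ary quadratic form over ℚ), and let S₂ be a rational symmetric N₂×N₂ matrix that is anisotropic over ℚ, i.e., yᵀS₂y ≠ 0 for all nonzero y ∈ ℚᴺ². Then {xᵀSx : 0 ≠ x ∈ ℚᴺ} ⊄ {yᵀS₂y : 0 ≠ y ∈ ℚᴺ²}. -/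
open Matrix
theorem Int.exists_squarefree_mul_sq {c : ℤ} (hc : c ≠ 0) :
    ∃ n s : ℤ, Squarefree n ∧ s ≠ 0 ∧ c = n * s ^ 2 := by
  obtain ⟨a, b, hab, ha⟩ := Nat.sq_mul_squarefree c.natAbs
  refine ⟨c.sign * a, b, ?_, ?_, ?_⟩
  · rw [← Int.squarefree_natAbs, Int.natAbs_mul, Int.natAbs_sign_of_ne_zero hc]
    simpa using ha
  · intro h
    have hb : b = 0 := by exact_mod_cast h
    exact hc (by simpa [hb, eq_comm] using hab)
  · conv_lhs => rw [← Int.sign_mul_natAbs c, ← hab]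
    push_cast
    ring

theorem Rat.exists_squarefree_int_mul_sq {q : ℚ} (hq : q ≠ 0) :
    ∃ (n : ℤ) (s : ℚ), Squarefree n ∧ s ≠ 0 ∧ q = n * s ^ 2 := by
  have hd : (q.den : ℚ) ≠ 0 := by exact_mod_cast q.den_nz
  obtain ⟨n, s, hn, hs, h⟩ := Int.exists_squarefree_mul_sq (c := q.num * q.den) (by simp [hq])
  refine ⟨n, s / q.den, hn, by positivity, ?_⟩
  have h' : (q.num * q.den : ℚ) = n * s ^ 2 := by exact_mod_cast h
  have hq' : q * q.den = q.num := Rat.mul_den_eq_num q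
  field_simp
  linear_combination (q.den : ℚ) * hq' + h'

theorem Rat.exists_primitive_int_smul {ι : Type*} [Fintype ι] {p : ℕ} (hp : p ≠ 1)
    {v : ι → ℚ} (hv : v ≠ 0) :
    ∃ (l : ℚ) (y : ι → ℤ), l ≠ 0 ∧ (∀ i, (y i : ℚ) = l * v i) ∧ ∃ i, ¬ (p : ℤ) ∣ y i := by
  classical
  obtain ⟨i₀, hi₀⟩ := Function.ne_iff.mp hv
  obtain ⟨d, hd⟩ := IsLocalization.exist_integer_multiples_of_finset (nonZeroDivisors ℤ)
    (Finset.univ.image v)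
  have hd0 : ((d : ℤ) : ℚ) ≠ 0 := by exact_mod_cast nonZeroDivisors.coe_ne_zero d
  have hz : ∀ i, ∃ z : ℤ, (z : ℚ) = (d : ℤ) * v i := fun i ↦ by
    obtain ⟨z, hz⟩ := hd (v i) (by simp)
    exact ⟨z, by simpa using hz⟩
  choose z hz using hz
  have hzi : z i₀ ≠ 0 := fun h ↦ by
    have := hz i₀
    simp only [h, Int.cast_zero] at this
    exact mul_ne_zero hd0 hi₀ this.symm
  obtain ⟨g, hg, hg1⟩ := Finset.extract_gcd z (s := Finset.univ) ⟨i₀, by simp⟩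
  have hG : ((Finset.univ.gcd z : ℤ) : ℚ) ≠ 0 := by
    intro h
    apply hzi
    rw [hg i₀ (by simp)]
    simp [Int.cast_eq_zero.mp h]
  refine ⟨(d : ℤ) / (Finset.univ.gcd z : ℤ), g, by positivity, fun i ↦ ?_, ?_⟩
  · have h1 : (z i : ℚ) = (Finset.univ.gcd z : ℤ) * g i := by exact_mod_cast hg i (by simp)
    rw [div_mul_eq_mul_div, ← hz, h1]
    field_simp
  · by_contra! h
    have : (p : ℤ) ∣ 1 := hg1 ▸ Finset.dvd_gcd fun i _ ↦ h i
    exact hp (Nat.dvd_one.mp (by exact_mod_cast this))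

theorem ZMod.exists_int_quadratic_eq {p : ℕ} [Fact p.Prime] (hp : p ≠ 2) {a b : ℤ}
    (ha : ¬ (p : ℤ) ∣ a) (hb : ¬ (p : ℤ) ∣ b) (r : ℤ) :
    ∃ x y : ℤ, (p : ℤ) ∣ a * x ^ 2 + b * y ^ 2 - r := by
  have ha' : (a : ZMod p) ≠ 0 := by rwa [Ne, ZMod.intCast_zmod_eq_zero_iff_dvd]
  have hb' : (b : ZMod p) ≠ 0 := by rwa [Ne, ZMod.intCast_zmod_eq_zero_iff_dvd]
  open Polynomial in
  obtain ⟨x, y, h⟩ := FiniteField.exists_root_sum_quadratic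
    (f := C (a : ZMod p) * X ^ 2 + C 0 * X + C 0)
    (g := C (b : ZMod p) * X ^ 2 + C 0 * X + C (-r : ZMod p))
    (degree_quadratic ha') (degree_quadratic hb')
    (by rw [ZMod.card]; exact (Nat.Prime.eq_two_or_odd Fact.out).resolve_left hp)
  obtain ⟨x, rfl⟩ := ZMod.intCast_surjective x
  obtain ⟨y, rfl⟩ := ZMod.intCast_surjective y
  refine ⟨x, y, (ZMod.intCast_zmod_eq_zero_iff_dvd _ _).mp ?_⟩
  push_cast
  simp at h
  linear_combination h

theorem Int.not_sq_dvd_of_squarefree {p : ℕ} [hp : Fact p.Prime] {c : ℤ} (hc : Squarefree c)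
    {u : ℤ} (hu : c = p * u) : ¬ (p : ℤ) ∣ u := by
  rintro ⟨t, rfl⟩
  have := hc p ⟨t, by rw [hu]; ring⟩
  rw [Int.isUnit_iff] at this
  have := hp.out.two_le
  omega

/-- A quaternary diagonal form over `ℚ` represents a nonzero square of `ℚ_p`, `p` odd. -/
theorem exists_diagonal_value_modEq_one {p : ℕ} [hpp : Fact p.Prime] (hp : p ≠ 2) {c : Fin 4 → ℤ}
    (hc : ∀ i, Squarefree (c i)) :
    ∃ (x : Fin 4 → ℤ) (k m : ℤ), k ≠ 0 ∧ (p : ℤ) ∣ m - 1 ∧ ∑ i, c i * x i ^ 2 = k ^ 2 * m := by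
  have hp0 : (p : ℤ) ≠ 0 := by exact_mod_cast hpp.out.ne_zero
  have hpi : Prime (p : ℤ) := Nat.prime_iff_prime_int.mp hpp.out
  by_cases h : ∃ i j, i ≠ j ∧ ¬ (p : ℤ) ∣ c i ∧ ¬ (p : ℤ) ∣ c j
  · obtain ⟨i, j, hij, hi, hj⟩ := h
    obtain ⟨a, b, hab⟩ := ZMod.exists_int_quadratic_eq hp hi hj 1
    refine ⟨fun k ↦ if k = i then a else if k = j then b else 0, 1, _, one_ne_zero, hab, ?_⟩
    rw [Fintype.sum_eq_add i j hij (fun k hk ↦ by simp [hk.1, hk.2])]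
    simp [hij.symm]
  · obtain ⟨l, hl⟩ : ∃ l, ∀ i, i ≠ l → (p : ℤ) ∣ c i := by
      by_cases h' : ∃ l, ¬ (p : ℤ) ∣ c l
      · obtain ⟨l, hl⟩ := h'
        exact ⟨l, fun i hi ↦ by by_contra hi'; exact h ⟨i, l, hi, hi', hl⟩⟩
      · push Not at h'
        exact ⟨0, fun i _ ↦ h' i⟩
    choose u hu using fun j : Fin 3 ↦ hl (l.succAbove j) (Fin.succAbove_ne l j)
    have hu' := fun j ↦ Int.not_sq_dvd_of_squarefree (hc _) (hu j)
    obtain ⟨a, b, w, hw⟩ := ZMod.exists_int_quadratic_eq hp (hu' 0) (hu' 1) (-u 2)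
    have h2 : ¬ (p : ℤ) ∣ 2 * u 2 := fun h ↦ by
      rcases hpi.dvd_or_dvd h with h | h
      · exact hp ((Nat.prime_dvd_prime_iff_eq hpp.out Nat.prime_two).mp (by exact_mod_cast h))
      · exact hu' 2 h
    obtain ⟨s, t, hst⟩ : IsCoprime (2 * u 2) (p : ℤ) :=
      ((Prime.coprime_iff_not_dvd hpi).mpr h2).symm
    -- replace the third coordinate `1` by `1 + p * s * (1 - w)`
    refine ⟨l.insertNth 0 ![a, b, 1 + p * (s * (1 - w))], p,
      w + 2 * u 2 * (s * (1 - w)) + p * (u 2 * (s * (1 - w)) ^ 2), hp0, ?_, ?_⟩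
    · refine ⟨-(t * (1 - w)) + u 2 * (s * (1 - w)) ^ 2, ?_⟩
      linear_combination (1 - w) * hst
    · rw [Fin.sum_univ_succAbove _ l]
      simp [Fin.sum_univ_three, hu]
      linear_combination p * hw

theorem exists_diagonal_emod_eight_of_odd :
    ∀ a ∈ [(1 : ℤ), 3, 5, 7], ∀ b ∈ [(1 : ℤ), 2, 3, 5, 6, 7], ∀ c ∈ [(1 : ℤ), 2, 3, 5, 6, 7],
    ∀ d ∈ [(1 : ℤ), 2, 3, 5, 6, 7],
    ∃ x ∈ [(0 : ℤ), 1, 2], ∃ y ∈ [(0 : ℤ), 1, 2], ∃ z ∈ [(0 : ℤ), 1, 2], ∃ w ∈ [(0 : ℤ), 1, 2],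
      (a * (x * x) + (b * (y * y) + (c * (z * z) + d * (w * w)))) % 8 = 1 := by
  decide +kernel

theorem exists_diagonal_emod_sixteen_of_odd :
    ∀ a ∈ [(1 : ℤ), 3, 5, 7], ∀ b ∈ [(1 : ℤ), 3, 5, 7], ∀ c ∈ [(1 : ℤ), 3, 5, 7],
    ∀ d ∈ [(1 : ℤ), 3, 5, 7],
    ∃ x ∈ [(0 : ℤ), 1, 2, 3], ∃ y ∈ [(0 : ℤ), 1, 2, 3], ∃ z ∈ [(0 : ℤ), 1, 2, 3],
    ∃ w ∈ [(0 : ℤ), 1, 2, 3],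
      (a * (x * x) + (b * (y * y) + (c * (z * z) + d * (w * w)))) % 16 = 2 := by
  decide +kernel

theorem Int.emod_four_ne_zero_of_squarefree {c : ℤ} (hc : Squarefree c) : c % 4 ≠ 0 := fun h ↦ by
  have := hc 2 (by omega)
  rw [Int.isUnit_iff] at this
  omega

/-- A quaternary diagonal form over `ℚ` represents a nonzero square of `ℚ_2`. -/
theorem exists_diagonal_value_emod_eight_eq_one {c : Fin 4 → ℤ} (hc : ∀ i, Squarefree (c i)) :
    ∃ (x : Fin 4 → ℤ) (k m : ℤ), k ≠ 0 ∧ m % 8 = 1 ∧ ∑ i, c i * x i ^ 2 = k ^ 2 * m := by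
  have hc4 := fun i ↦ Int.emod_four_ne_zero_of_squarefree (hc i)
  by_cases h : ∃ l, c l % 2 = 1
  · obtain ⟨l, hl⟩ := h
    have hmem : ∀ i, c i % 8 ∈ [(1 : ℤ), 2, 3, 5, 6, 7] := fun i ↦ by
      have := hc4 i
      simp only [List.mem_cons, List.not_mem_nil]
      omega
    obtain ⟨x, -, y, -, z, -, w, -, h⟩ := exists_diagonal_emod_eight_of_odd (c l % 8)
      (by simp only [List.mem_cons, List.not_mem_nil]; omega) _ (hmem (l.succAbove 0))
      _ (hmem (l.succAbove 1)) _ (hmem (l.succAbove 2))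
    refine ⟨l.insertNth x ![y, z, w], 1, _, one_ne_zero, ?_, by rw [one_pow, one_mul]⟩
    rw [Fin.sum_univ_succAbove _ l, ← h]
    simp only [Fin.insertNth_apply_same, Fin.insertNth_apply_succAbove, Fin.sum_univ_three]
    simp [Int.add_emod, Int.mul_emod, sq, add_assoc]
  · have h2 : ∀ i, (2 : ℤ) ∣ c i := fun i ↦ by
      have := not_exists.mp h i
      omega
    choose u hu using h2
    have hodd : ∀ i, ∃ s : ℤ, (u i * (s * s)) % 16 ∈ [(1 : ℤ), 3, 5, 7] := fun i ↦ by
      have h4 := hc4 i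
      have h16 : u i % 16 ∈ [(1 : ℤ), 3, 5, 7] ∨ u i * 9 % 16 ∈ [(1 : ℤ), 3, 5, 7] := by
        rw [hu i] at h4
        have hcases : u i % 16 = 1 ∨ u i % 16 = 3 ∨ u i % 16 = 5 ∨ u i % 16 = 7 ∨
            u i % 16 = 9 ∨ u i % 16 = 11 ∨ u i % 16 = 13 ∨ u i % 16 = 15 := by omega
        rcases hcases with h | h | h | h | h | h | h | h <;> simp [Int.mul_emod, h]
      rcases h16 with h16 | h16
      · exact ⟨1, by simpa using h16⟩
      · exact ⟨3, h16⟩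
    choose s hs using hodd
    obtain ⟨x, -, y, -, z, -, w, -, h⟩ :=
      exists_diagonal_emod_sixteen_of_odd _ (hs 0) _ (hs 1) _ (hs 2) _ (hs 3)
    obtain ⟨m, hm⟩ : ∃ m, u 0 * (s 0 * s 0) * (x * x) + (u 1 * (s 1 * s 1) * (y * y) +
        (u 2 * (s 2 * s 2) * (z * z) + u 3 * (s 3 * s 3) * (w * w))) = 16 * m + 2 := by
      refine ⟨_, ((Int.mul_ediv_add_emod _ 16).symm.trans (congrArg _ ?_))⟩
      rw [← h]
      simp [Int.add_emod, Int.mul_emod]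
    refine ⟨![s 0 * x, s 1 * y, s 2 * z, s 3 * w], 2, 8 * m + 1, two_ne_zero, by omega, ?_⟩
    simp [Fin.sum_univ_four, hu]
    linear_combination 2 * hm

theorem Int.two_dvd_of_sum_three_sq_eq {m : ℤ} (hm : m % 8 = 7) (x y z : ℤ) {w : ℤ}
    (h : x ^ 2 + y ^ 2 + z ^ 2 = m * w ^ 2) : 2 ∣ x ∧ 2 ∣ y ∧ 2 ∣ z ∧ 2 ∣ w := by
  have h8 : ((x : ZMod 8)) ^ 2 + (y : ZMod 8) ^ 2 + (z : ZMod 8) ^ 2 = 7 * (w : ZMod 8) ^ 2 := by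
    have : (m : ZMod 8) = 7 := by
      rw [← Int.emod_add_mul_ediv m 8, hm]
      push_cast
      rw [show (8 : ZMod 8) = 0 from rfl]
      ring
    rw [← this]
    exact_mod_cast congrArg (Int.cast : ℤ → ZMod 8) h
  have key : ∀ x y z w : ZMod 8, x ^ 2 + y ^ 2 + z ^ 2 = 7 * w ^ 2 →
      4 * x = 0 ∧ 4 * y = 0 ∧ 4 * z = 0 ∧ 4 * w = 0 := by decide +kernel
  have h4 : ∀ t : ℤ, 4 * (t : ZMod 8) = 0 → 2 ∣ t := fun t ht ↦ by
    have := (ZMod.intCast_zmod_eq_zero_iff_dvd (4 * t) 8).mp (by exact_mod_cast ht)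
    push_cast at this
    omega
  obtain ⟨h1, h2, h3, h5⟩ := key _ _ _ _ h8
  exact ⟨h4 _ h1, h4 _ h2, h4 _ h3, h4 _ h5⟩

/-- `m` is a value of the ternary form `⟨a, b, -ab⟩`, the squares of pure quaternions in `(a, b)`. -/
def IsPureQuaternionSq (a b m : ℚ) : Prop :=
  ∃ x y z : ℚ, a * x ^ 2 + b * y ^ 2 - a * b * z ^ 2 = m

namespace IsPureQuaternionSq

variable {a b m : ℚ}

theorem symm (h : IsPureQuaternionSq a b m) : IsPureQuaternionSq b a m := by
  obtain ⟨x, y, z, h⟩ := h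
  exact ⟨y, x, z, by linear_combination h⟩

theorem comm : IsPureQuaternionSq a b m ↔ IsPureQuaternionSq b a m := ⟨symm, symm⟩

theorem of_mul_sq {k : ℚ} (hk : k ≠ 0) (h : IsPureQuaternionSq a b (k ^ 2 * m)) :
    IsPureQuaternionSq a b m := by
  obtain ⟨x, y, z, h⟩ := h
  refine ⟨x / k, y / k, z / k, ?_⟩
  field_simp
  linear_combination h

theorem mul_sq_left {s : ℚ} (hs : s ≠ 0) :
    IsPureQuaternionSq (a * s ^ 2) b m ↔ IsPureQuaternionSq a b m := by
  constructor <;> rintro ⟨x, y, z, h⟩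
  · exact ⟨s * x, y, s * z, by linear_combination h⟩
  · refine ⟨x / s, y, z / s, ?_⟩
    field_simp
    linear_combination h

theorem mul_sq_right {s : ℚ} (hs : s ≠ 0) :
    IsPureQuaternionSq a (b * s ^ 2) m ↔ IsPureQuaternionSq a b m := by
  rw [comm, mul_sq_left hs, comm]

/-- `b` may be replaced by `b'` when `b * b'` is a nonzero norm from `ℚ(√a)`. -/
theorem of_mul_eq_norm {b' t : ℚ} (hb' : b' ≠ 0) (ht : b * b' = t ^ 2 - a)
    (h : IsPureQuaternionSq a b m) : IsPureQuaternionSq a b' m := by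
  obtain ⟨x, y, z, h⟩ := h
  refine ⟨x, (t * y + a * z) / b', (y + t * z) / b', ?_⟩
  field_simp
  linear_combination b' * h - (y ^ 2 - a * z ^ 2) * ht

end IsPureQuaternionSq

theorem Int.exists_dvd_sq_sub_of_squarefree {a b : ℤ} (hb : Squarefree b)
    (h : ∀ p : ℤ, Prime p → p ∣ b → ∃ t : ℤ, p ∣ t ^ 2 - a) :
    ∃ t : ℤ, b ∣ t ^ 2 - a := by
  induction b using UniqueFactorizationMonoid.induction_on_prime with
  | h₁ => exact absurd hb not_squarefree_zero
  | h₂ b hu => exact ⟨0, hu.dvd⟩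
  | h₃ b p hb0 hp ih =>
    obtain ⟨t₂, ht₂⟩ := ih (hb.squarefree_of_dvd (dvd_mul_left b p))
      fun q hq hqb ↦ h q hq (hqb.mul_left p)
    obtain ⟨t₁, ht₁⟩ := h p hp (dvd_mul_right p b)
    have hcop : IsCoprime p b := (squarefree_mul_iff.mp hb).1.isCoprime
    obtain ⟨u, v, huv⟩ := hcop
    refine ⟨t₁ * (v * b) + t₂ * (u * p), IsCoprime.mul_dvd ⟨u, v, huv⟩ ?_ ?_⟩
    · obtain ⟨s, hs⟩ := ht₁
      refine ⟨s + u * ((t₂ - t₁) * (2 * t₁ + u * p * (t₂ - t₁))), ?_⟩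
      have : v * b = 1 - u * p := by linear_combination huv
      rw [this]
      linear_combination hs
    · obtain ⟨s, hs⟩ := ht₂
      refine ⟨s + v * ((t₁ - t₂) * (2 * t₂ + v * b * (t₁ - t₂))), ?_⟩
      have : u * p = 1 - v * b := by linear_combination huv
      rw [this]
      linear_combination hs

theorem Int.exists_dvd_sq_sub_abs_le {a b t : ℤ} (hb : b ≠ 0) (h : b ∣ t ^ 2 - a) :
    ∃ t : ℤ, b ∣ t ^ 2 - a ∧ 2 * |t| ≤ |b| := by
  refine ⟨t.bmod b.natAbs, ?_, ?_⟩
  · have h1 : b ∣ t.bmod b.natAbs - t := by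
      rw [← Int.natAbs_dvd]
      exact Int.dvd_bmod_sub_self
    have : (t.bmod b.natAbs) ^ 2 - a = (t.bmod b.natAbs - t) * (t.bmod b.natAbs + t) +
        (t ^ 2 - a) := by ring
    rw [this]
    exact dvd_add (h1.mul_right _) h
  · have h1 := Int.bmod_lt (x := t) (m := b.natAbs) (by omega)
    have h2 := Int.le_bmod (x := t) (m := b.natAbs) (by omega)
    rw [Int.abs_eq_natAbs b]
    rcases abs_cases (t.bmod b.natAbs) with h | h <;> omega

theorem Int.exists_dvd_sq_sub_of_dvd_sq_sub_mul_sq {p a w x : ℤ} (hp : Prime p)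
    (h : p ∣ w ^ 2 - a * x ^ 2) (hx : ¬ p ∣ x) : ∃ t : ℤ, p ∣ t ^ 2 - a := by
  obtain ⟨r, s, hrs⟩ : IsCoprime x p := ((Prime.coprime_iff_not_dvd hp).mpr hx).symm
  obtain ⟨q, hq⟩ := h
  refine ⟨r * w, r ^ 2 * q - a * s * (1 + r * x), ?_⟩
  linear_combination r ^ 2 * hq + a * (1 + r * x) * hrs

theorem IsPureQuaternionSq.exists_dvd_sq_sub {p : ℕ} [hpp : Fact p.Prime] {a b m : ℤ}
    (hb : Squarefree b) (hpb : (p : ℤ) ∣ b) (hm : (p : ℤ) ∣ m - 1)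
    (h : IsPureQuaternionSq a b m) : ∃ t : ℤ, (p : ℤ) ∣ t ^ 2 - a := by
  have hp : Prime (p : ℤ) := Nat.prime_iff_prime_int.mp hpp.out
  obtain ⟨x, y, z, h⟩ := h
  obtain ⟨l, v, hl, hv, hprim⟩ := Rat.exists_primitive_int_smul hpp.out.ne_one
    (v := ![x, y, z, 1]) (fun h ↦ one_ne_zero (congrFun h 3))
  have e : a * v 0 ^ 2 + b * v 1 ^ 2 - a * b * v 2 ^ 2 = m * v 3 ^ 2 := by
    have h0 := hv 0
    have h1 := hv 1
    have h2 := hv 2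
    have h3 := hv 3
    simp only [Matrix.cons_val] at h0 h1 h2 h3
    have : (a * v 0 ^ 2 + b * v 1 ^ 2 - a * b * v 2 ^ 2 : ℚ) = m * v 3 ^ 2 := by
      rw [h0, h1, h2, h3]
      linear_combination l ^ 2 * h
    exact_mod_cast this
  obtain ⟨u, hu⟩ := hpb
  have hpu := Int.not_sq_dvd_of_squarefree hb hu
  obtain ⟨n, hn⟩ := hm
  have h03 : (p : ℤ) ∣ v 3 ^ 2 - a * v 0 ^ 2 :=
    ⟨u * (v 1 ^ 2 - a * v 2 ^ 2) - n * v 3 ^ 2, by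
      linear_combination -e - v 3 ^ 2 * hn + (v 1 ^ 2 - a * v 2 ^ 2) * hu⟩
  by_cases h0 : (p : ℤ) ∣ v 0
  swap
  · exact Int.exists_dvd_sq_sub_of_dvd_sq_sub_mul_sq hp h03 h0
  have h3 : (p : ℤ) ∣ v 3 := hp.dvd_of_dvd_pow (n := 2) <|
    (dvd_sub_left ((dvd_pow h0 two_ne_zero).mul_left a)).mp h03
  have h12 : (p : ℤ) ∣ v 1 ^ 2 - a * v 2 ^ 2 := by
    obtain ⟨r, hr⟩ := h0
    obtain ⟨s, hs⟩ := h3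
    refine (hp.dvd_or_dvd (a := u) ⟨m * s ^ 2 - a * r ^ 2, ?_⟩).resolve_left hpu
    apply mul_left_cancel₀ hp.ne_zero
    rw [hr, hs, hu] at e
    linear_combination e
  by_cases h2 : (p : ℤ) ∣ v 2
  swap
  · exact Int.exists_dvd_sq_sub_of_dvd_sq_sub_mul_sq hp h12 h2
  have h1 : (p : ℤ) ∣ v 1 := hp.dvd_of_dvd_pow (n := 2) <|
    (dvd_sub_left (((dvd_pow h2 two_ne_zero)).mul_left a)).mp h12
  obtain ⟨i, hi⟩ := hprim
  fin_cases i <;> contradiction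

/-- A quaternion algebra over `ℚ` unramified at all odd primes is split or `(-1, -1)`. -/
theorem IsPureQuaternionSq.one_or_neg_one_neg_one {a b : ℤ} (ha : Squarefree a) (hb : Squarefree b)
    (h : ∀ p : ℕ, p.Prime → p ≠ 2 →
      ∃ m : ℤ, (p : ℤ) ∣ m - 1 ∧ IsPureQuaternionSq a b m) :
    IsPureQuaternionSq a b 1 ∨
      ∀ m, IsPureQuaternionSq a b m → IsPureQuaternionSq (-1) (-1) m := by
  induction hn : a.natAbs + b.natAbs using Nat.strong_induction_on generalizing a b with
  | _ n ih =>
  subst hn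
  wlog hab : a.natAbs ≤ b.natAbs generalizing a b
  · have := this hb ha (fun p hp hp2 ↦ by simpa only [comm] using h p hp hp2)
      (fun n hn ↦ ih n (by omega)) (by omega)
    simpa only [comm (a := (a : ℚ))] using this
  have ha0 := ha.ne_zero
  have hb0 := hb.ne_zero
  by_cases hb1 : b.natAbs = 1
  · have ha1 : a = 1 ∨ a = -1 := by omega
    have hb1 : b = 1 ∨ b = -1 := by omega
    rcases ha1 with rfl | rfl
    · exact .inl ⟨1, 0, 0, by simp⟩
    rcases hb1 with rfl | rfl
    · exact .inl ⟨0, 1, 0, by simp⟩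
    · exact .inr fun m hm ↦ by simpa using hm
  obtain ⟨t, ht⟩ : ∃ t : ℤ, b ∣ t ^ 2 - a := by
    refine Int.exists_dvd_sq_sub_of_squarefree hb fun p hp hpb ↦ ?_
    rw [← Int.natAbs_dvd] at hpb
    simp only [← Int.natAbs_dvd (a := p)]
    have hpn := Int.prime_iff_natAbs_prime.mp hp
    have : Fact p.natAbs.Prime := ⟨hpn⟩
    by_cases hp2 : p.natAbs = 2
    · rw [hp2]
      exact ⟨a, by simpa [sq, mul_sub] using (Int.even_mul_pred_self a).two_dvd⟩
    · obtain ⟨m, hm, hr⟩ := h _ hpn hp2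
      exact hr.exists_dvd_sq_sub hb hpb hm
  obtain ⟨t, ⟨c, hc⟩, htb⟩ := Int.exists_dvd_sq_sub_abs_le hb0 ht
  have hcQ : (b * c : ℚ) = t ^ 2 - a := by exact_mod_cast hc.symm
  by_cases hc0 : c = 0
  · left
    have hat : (a : ℚ) = t ^ 2 := by rw [hc0] at hcQ; push_cast at hcQ; linear_combination hcQ
    have ht0 : (t : ℚ) ≠ 0 := by
      intro h0
      rw [h0] at hat
      exact ha0 (by simpa using hat)
    exact ⟨1 / t, 0, 0, by rw [hat]; field_simp; simp⟩
  have hcb : c.natAbs < b.natAbs := by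
    zify at hab hb1 ⊢
    by_contra! hbc
    have h1 : |b| * |c| ≤ |t| ^ 2 + |a| := by
      rw [← abs_mul, ← hc, ← abs_pow]
      exact abs_sub _ _
    have h2 : 1 ≤ |b| := Int.one_le_abs hb0
    have h3 : 2 ≤ |b| := by omega
    nlinarith [abs_nonneg t, mul_le_mul_of_nonneg_left hbc (abs_nonneg b)]
  obtain ⟨b', s, hb', hs0, hcs'⟩ := Int.exists_squarefree_mul_sq hc0
  have hs : (s : ℚ) ≠ 0 := by exact_mod_cast hs0
  have hcs : (c : ℚ) = b' * s ^ 2 := by exact_mod_cast hcs'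
  have hb'c : b'.natAbs ≤ c.natAbs :=
    Int.natAbs_le_of_dvd_ne_zero ⟨s ^ 2, hcs'⟩ hc0
  have hfwd : ∀ m, IsPureQuaternionSq a b m → IsPureQuaternionSq a b' m := fun m hm ↦ by
    rw [← mul_sq_right hs, ← hcs]
    exact hm.of_mul_eq_norm (by exact_mod_cast hc0) hcQ
  have hbwd : ∀ m, IsPureQuaternionSq a b' m → IsPureQuaternionSq a b m := fun m hm ↦ by
    rw [← mul_sq_right hs, ← hcs] at hm
    exact hm.of_mul_eq_norm (by exact_mod_cast hb0) (by rw [mul_comm]; exact hcQ)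
  have := ih _ (by omega) ha hb' (fun p hp hp2 ↦ by
    obtain ⟨m, hm, hr⟩ := h p hp hp2
    exact ⟨m, hm, hfwd m hr⟩) rfl
  exact this.imp (hbwd 1) fun h m hm ↦ h m (hfwd m hm)

theorem IsPureQuaternionSq.exists_isotropic {a b : ℚ} (h : IsPureQuaternionSq a b 1) :
    ∃ x y z : ℚ, (x ≠ 0 ∨ y ≠ 0 ∨ z ≠ 0) ∧ a * x ^ 2 + b * y ^ 2 = z ^ 2 := by
  obtain ⟨x, y, z, h⟩ := h
  by_cases h0 : x ^ 2 - b * z ^ 2 = 0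
  · by_cases hz : z = 0
    · have hx : x = 0 := by simpa [hz] using h0
      exact ⟨0, y, 1, by simp, by rw [hx, hz] at h; linear_combination h⟩
    · exact ⟨0, z, x, by simp [hz], by linear_combination -h0⟩
  · exact ⟨x ^ 2 - b * z ^ 2, z + x * y, x + b * y * z, .inl h0, by
      linear_combination (x ^ 2 - b * z ^ 2) * h⟩

theorem neg_one_neg_one_not_isPureQuaternionSq {m : ℤ} (hm : m % 8 = 1) :
    ¬ IsPureQuaternionSq (-1) (-1) m := by
  rintro ⟨x, y, z, h⟩
  obtain ⟨l, v, hl, hv, i, hi⟩ := Rat.exists_primitive_int_smul (p := 2) (by decide)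
    (v := ![x, y, z, 1]) (fun h ↦ one_ne_zero (congrFun h 3))
  have e : v 0 ^ 2 + v 1 ^ 2 + v 2 ^ 2 = -m * v 3 ^ 2 := by
    have h0 := hv 0
    have h1 := hv 1
    have h2 := hv 2
    have h3 := hv 3
    simp only [Matrix.cons_val] at h0 h1 h2 h3
    have : (v 0 ^ 2 + v 1 ^ 2 + v 2 ^ 2 : ℚ) = -m * v 3 ^ 2 := by
      rw [h0, h1, h2, h3]
      linear_combination -l ^ 2 * h
    exact_mod_cast this
  obtain ⟨h0, h1, h2, h3⟩ := Int.two_dvd_of_sum_three_sq_eq (by omega) _ _ _ e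
  fin_cases i <;> contradiction

/-- A quaternary diagonal form over `ℚ` takes a value which is not the square of a pure quaternion
in a given division quaternion algebra. -/
theorem exists_diagonal_value_not_isPureQuaternionSq {a b : ℚ} (ha : a ≠ 0) (hb : b ≠ 0)
    (hab : ¬ IsPureQuaternionSq a b 1) {c : Fin 4 → ℚ} (hc : ∀ i, c i ≠ 0) :
    ∃ x : Fin 4 → ℚ, x ≠ 0 ∧ ¬ IsPureQuaternionSq a b (∑ i, c i * x i ^ 2) := by
  by_contra! H
  obtain ⟨a', s, ha', hs, rfl⟩ := Rat.exists_squarefree_int_mul_sq ha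
  obtain ⟨b', t, hb', ht, rfl⟩ := Rat.exists_squarefree_int_mul_sq hb
  simp only [IsPureQuaternionSq.mul_sq_left hs, IsPureQuaternionSq.mul_sq_right ht] at hab H
  choose d r hd hr hcd using fun i ↦ Rat.exists_squarefree_int_mul_sq (hc i)
  have H' : ∀ (x : Fin 4 → ℤ) (k m : ℤ), k ≠ 0 → m ≠ 0 → ∑ i, d i * x i ^ 2 = k ^ 2 * m →
      IsPureQuaternionSq a' b' m := fun x k m hk hm hx ↦ by
    have hx0 : (fun i ↦ x i / r i : Fin 4 → ℚ) ≠ 0 := fun h ↦ by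
      have h0 : ∀ i, x i = 0 := fun i ↦ by simpa [hr i] using congrFun h i
      simp [h0, hk, hm] at hx
    refine .of_mul_sq (k := k) (by exact_mod_cast hk) ?_
    convert H _ hx0 using 1
    have : (∑ i, d i * x i ^ 2 : ℚ) = k ^ 2 * m := by exact_mod_cast hx
    rw [← this]
    refine Finset.sum_congr rfl fun i _ ↦ ?_
    have := hr i
    rw [hcd i]
    field_simp
  rcases IsPureQuaternionSq.one_or_neg_one_neg_one ha' hb' (fun p hp hp2 ↦ by
    have : Fact p.Prime := ⟨hp⟩
    obtain ⟨x, k, m, hk, hm, hx⟩ := exists_diagonal_value_modEq_one hp2 hd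
    refine ⟨m, hm, H' x k m hk ?_ hx⟩
    rintro rfl
    have := Int.natCast_dvd.mp hm
    exact hp.ne_one (by simpa using this)) with h | h
  · exact hab h
  · obtain ⟨x, k, m, hk, hm, hx⟩ := exists_diagonal_value_emod_eight_eq_one hd
    exact neg_one_neg_one_not_isPureQuaternionSq hm (h m (H' x k m hk (by omega) hx))

/-- The diagonal form with coefficients `w` is anisotropic. -/
def DiagonalAnisotropic {n : ℕ} (w : Fin n → ℚ) : Prop :=
  ∀ x : Fin n → ℚ, x ≠ 0 → ∑ i, w i * x i ^ 2 ≠ 0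

/-- Every value of the diagonal form `v` at a nonzero vector is such a value of `w`. -/
def DiagonalValuesSubset {m n : ℕ} (v : Fin m → ℚ) (w : Fin n → ℚ) : Prop :=
  ∀ x : Fin m → ℚ, x ≠ 0 → ∃ y : Fin n → ℚ, y ≠ 0 ∧ ∑ i, v i * x i ^ 2 = ∑ i, w i * y i ^ 2

theorem DiagonalAnisotropic.ne_zero {n : ℕ} {w : Fin n → ℚ} (hw : DiagonalAnisotropic w)
    (i : Fin n) : w i ≠ 0 := fun h ↦ by
  refine hw (Pi.single i 1) (by simp) (Finset.sum_eq_zero fun j _ ↦ ?_)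
  by_cases hj : j = i
  · simp [hj, h]
  · simp [hj]

theorem not_diagonalValuesSubset_three {v : Fin 4 → ℚ} {w : Fin 3 → ℚ} (hv : ∀ i, v i ≠ 0)
    (hw : DiagonalAnisotropic w) : ¬ DiagonalValuesSubset v w := fun H ↦ by
  have h0 := hw.ne_zero 0
  have h1 := hw.ne_zero 1
  have h2 := hw.ne_zero 2
  obtain ⟨x, hx, hx'⟩ := exists_diagonal_value_not_isPureQuaternionSq
    (a := -(w 1 * w 2)) (b := -(w 0 * w 2)) (c := fun i ↦ -(w 0 * w 1 * w 2) * v i)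
    (by simp [*]) (by simp [*]) (fun h ↦ by
      obtain ⟨x, y, z, hne, h⟩ := h.exists_isotropic
      refine hw ![y, x, z / w 2] (fun h ↦ ?_) ?_
      · have e0 := congrFun h 0
        have e1 := congrFun h 1
        have e2 := congrFun h 2
        simp [h2] at e0 e1 e2
        simp [e0, e1, e2] at hne
      · simp [Fin.sum_univ_three]
        field_simp
        linear_combination -h) (by simp [*])
  obtain ⟨y, -, hy⟩ := H x hx
  refine hx' ⟨w 0 * y 0, w 1 * y 1, y 2, ?_⟩
  simp only [mul_assoc (-(w 0 * w 1 * w 2)), ← Finset.mul_sum, hy, Fin.sum_univ_three]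
  ring

theorem not_diagonalValuesSubset_of_extension {n : ℕ}
    (IH : ∀ (v : Fin (n + 2) → ℚ) (w : Fin (n + 1) → ℚ), (∀ i, v i ≠ 0) →
      DiagonalAnisotropic w → ¬ DiagonalValuesSubset v w)
    {v : Fin (n + 1) → ℚ} {w : Fin n → ℚ} (hv : ∀ i, v i ≠ 0) {e : ℚ}
    (he : DiagonalAnisotropic (Fin.cons e w : Fin (n + 1) → ℚ)) : ¬ DiagonalValuesSubset v w := by
  intro H
  have he0 : e ≠ 0 := by simpa using he.ne_zero 0
  refine IH (Fin.cons e v) _ (Fin.cases (by simpa) (by simpa)) he fun x hx ↦ ?_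
  by_cases hx0 : Fin.tail x = 0
  · have h0 : x 0 ≠ 0 := fun h ↦ hx (by
      ext i
      exact Fin.cases h (congrFun hx0) i)
    refine ⟨Fin.cons (x 0) 0, fun h ↦ h0 (by simpa using congrFun h 0), ?_⟩
    have : ∀ i, x (Fin.succ i) = 0 := congrFun hx0
    simp [Fin.sum_univ_succ (n := n), Fin.sum_univ_succ (n := n + 1), this]
  · obtain ⟨y, hy, h⟩ := H _ hx0
    refine ⟨Fin.cons (x 0) y, fun h ↦ hy ?_, ?_⟩
    · ext i
      simpa using congrFun h i.succ
    · rw [Fin.sum_univ_succ, Fin.sum_univ_succ (fun i ↦ (Fin.cons e w : Fin (n + 1) → ℚ) i * _)]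
      simp only [Fin.cons_zero, Fin.cons_succ]
      exact congrArg (e * x 0 ^ 2 + ·) h

theorem Int.eq_one_or_two_of_squarefree {d : ℤ} (hd : Squarefree d) (hpos : 0 < d)
    (h : ∀ p : ℕ, p.Prime → (p : ℤ) ∣ d → p = 2) : d = 1 ∨ d = 2 := by
  have hpow := Nat.eq_prime_pow_of_unique_prime_dvd (n := d.natAbs) (p := 2) (by omega)
    fun {q} hq hqd ↦ h q hq (Int.natCast_dvd.mpr hqd)
  have hsq : Squarefree (2 ^ d.natAbs.primeFactorsList.length) :=
    hpow ▸ Int.squarefree_natAbs.mpr hd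
  generalize d.natAbs.primeFactorsList.length = k at hpow hsq
  rcases eq_or_ne k 0 with rfl | hk
  · omega
  · obtain ⟨-, rfl⟩ := (Nat.squarefree_pow_iff (by decide) hk).mp hsq
    omega

/-- The norm form of a quadratic field over `ℚ` is not universal. -/
theorem exists_ne_sq_sub_mul_sq {d : ℚ} (hd : ¬ IsSquare d) :
    ∃ f : ℚ, ∀ x y : ℚ, x ^ 2 - d * y ^ 2 ≠ f := by
  obtain ⟨d, s, hdsq, hs, rfl⟩ := Rat.exists_squarefree_int_mul_sq
    (q := d) (by rintro rfl; exact hd IsSquare.zero)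
  suffices ∃ f : ℤ, ∀ x y : ℚ, x ^ 2 - d * y ^ 2 ≠ f by
    obtain ⟨f, hf⟩ := this
    exact ⟨f, fun x y h ↦ hf x (s * y) (by linear_combination h)⟩
  have hprim : ∀ {p : ℕ}, p ≠ 1 → ∀ {f : ℤ} {x y : ℚ}, x ^ 2 - d * y ^ 2 = f →
      ∃ v : Fin 3 → ℤ, v 0 ^ 2 - d * v 1 ^ 2 = f * v 2 ^ 2 ∧ ∃ i, ¬ (p : ℤ) ∣ v i := by
    intro p hp f x y h
    obtain ⟨l, v, -, hv, hi⟩ := Rat.exists_primitive_int_smul hp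
      (v := ![x, y, 1]) (fun h ↦ one_ne_zero (congrFun h 2))
    have h0 := hv 0
    have h1 := hv 1
    have h2 := hv 2
    simp only [Matrix.cons_val] at h0 h1 h2
    have : (v 0 ^ 2 - d * v 1 ^ 2 : ℚ) = f * v 2 ^ 2 := by
      rw [h0, h1, h2]
      linear_combination l ^ 2 * h
    exact ⟨v, by exact_mod_cast this, hi⟩
  rcases lt_or_gt_of_ne hdsq.ne_zero with hneg | hpos
  · refine ⟨-1, fun x y h ↦ ?_⟩
    have : (d : ℚ) < 0 := by exact_mod_cast hneg
    push_cast at h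
    nlinarith [sq_nonneg x, mul_nonneg (neg_nonneg.mpr this.le) (sq_nonneg y)]
  by_cases hodd : ∃ p : ℕ, p.Prime ∧ (p : ℤ) ∣ d ∧ p ≠ 2
  · obtain ⟨p, hpp, ⟨u, hu⟩, hp2⟩ := hodd
    have : Fact p.Prime := ⟨hpp⟩
    have hp : Prime (p : ℤ) := Nat.prime_iff_prime_int.mp hpp
    obtain ⟨n, hn⟩ := FiniteField.exists_nonsquare (F := ZMod p) (by rwa [ZMod.ringChar_zmod_n])
    obtain ⟨n, rfl⟩ := ZMod.intCast_surjective n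
    refine ⟨n, fun x y h ↦ ?_⟩
    obtain ⟨v, e, i, hi⟩ := hprim hpp.ne_one h
    have h02 : (p : ℤ) ∣ v 0 ^ 2 - n * v 2 ^ 2 := ⟨u * v 1 ^ 2, by
      linear_combination e + v 1 ^ 2 * hu⟩
    by_cases h2 : (p : ℤ) ∣ v 2
    · have h0 : (p : ℤ) ∣ v 0 := hp.dvd_of_dvd_pow (n := 2) <|
        (dvd_sub_left ((dvd_pow h2 two_ne_zero).mul_left n)).mp h02
      have h1 : (p : ℤ) ∣ v 1 := by
        obtain ⟨r, hr⟩ := h0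
        obtain ⟨t, ht⟩ := h2
        refine hp.dvd_of_dvd_pow (n := 2) ((hp.dvd_or_dvd (a := u)
          ⟨r ^ 2 - n * t ^ 2, ?_⟩).resolve_left (Int.not_sq_dvd_of_squarefree hdsq hu))
        apply mul_left_cancel₀ hp.ne_zero
        rw [hr, ht, hu] at e
        linear_combination -e
      fin_cases i <;> contradiction
    · obtain ⟨t, ht⟩ := Int.exists_dvd_sq_sub_of_dvd_sq_sub_mul_sq hp h02 h2
      refine hn ⟨t, ?_⟩
      have := (ZMod.intCast_zmod_eq_zero_iff_dvd _ _).mpr ht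
      push_cast at this
      linear_combination -this
  · push Not at hodd
    rcases Int.eq_one_or_two_of_squarefree hdsq hpos hodd with rfl | rfl
    · exact absurd ⟨s, by push_cast; ring⟩ hd
    refine ⟨3, fun x y h ↦ ?_⟩
    obtain ⟨v, e, i, hi⟩ := hprim (p := 3) (by decide) h
    have key : ∀ a b : ZMod 3, a ^ 2 - 2 * b ^ 2 = 0 → a = 0 ∧ b = 0 := by decide
    have h01 := key (v 0) (v 1) (by
      have := congrArg (Int.cast : ℤ → ZMod 3) e
      push_cast at this
      rw [this, show (3 : ZMod 3) = 0 from rfl, zero_mul])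
    simp only [ZMod.intCast_zmod_eq_zero_iff_dvd] at h01
    obtain ⟨h0, h1⟩ := h01
    have h2 : ((3 : ℕ) : ℤ) ∣ v 2 := by
      obtain ⟨r, hr⟩ := h0
      obtain ⟨t, ht⟩ := h1
      push_cast at hr ht ⊢
      refine Int.prime_three.dvd_of_dvd_pow (n := 2) ⟨r ^ 2 - 2 * t ^ 2, ?_⟩
      rw [hr, ht] at e
      linarith
    fin_cases i <;> contradiction

theorem DiagonalAnisotropic.cons_self {w : Fin 1 → ℚ} (hw : DiagonalAnisotropic w) :
    DiagonalAnisotropic (Fin.cons (w 0) w : Fin 2 → ℚ) := fun x hx h ↦ by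
  have h0 := hw.ne_zero 0
  have h' : x 0 ^ 2 + x 1 ^ 2 = 0 := by
    simpa [Fin.sum_univ_succ, ← mul_add, h0] using h
  have := (add_eq_zero_iff_of_nonneg (sq_nonneg _) (sq_nonneg _)).mp h'
  exact hx (by ext i; fin_cases i <;> simp_all)

theorem DiagonalAnisotropic.exists_cons {w : Fin 2 → ℚ} (hw : DiagonalAnisotropic w) :
    ∃ e, DiagonalAnisotropic (Fin.cons e w : Fin 3 → ℚ) := by
  have h0 := hw.ne_zero 0
  have h1 := hw.ne_zero 1
  obtain ⟨f, hf⟩ := exists_ne_sq_sub_mul_sq (d := -(w 1 / w 0)) (by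
    rintro ⟨r, hr⟩
    refine hw ![r, 1] (fun h ↦ one_ne_zero (congrFun h 1)) ?_
    field_simp at hr
    simp
    linear_combination -hr)
  refine ⟨-(w 0 * f), fun x hx h ↦ ?_⟩
  rw [Fin.sum_univ_succ] at h
  simp only [Fin.cons_zero, Fin.cons_succ] at h
  by_cases hx0 : x 0 = 0
  · refine hw (fun i ↦ x i.succ) (fun h' ↦ hx ?_) (by simpa [hx0] using h)
    ext i
    exact Fin.cases hx0 (congrFun h') i
  · refine hf (x 1 / x 0) (x 2 / x 0) ?_
    simp [Fin.sum_univ_two] at h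
    field_simp
    linear_combination h

theorem not_diagonalValuesSubset {n : ℕ} (hn : 1 ≤ n) (hn' : n < 4) {v : Fin (n + 1) → ℚ}
    {w : Fin n → ℚ} (hv : ∀ i, v i ≠ 0) (hw : DiagonalAnisotropic w) :
    ¬ DiagonalValuesSubset v w := by
  have two : ∀ (v : Fin 3 → ℚ) (w : Fin 2 → ℚ), (∀ i, v i ≠ 0) →
      DiagonalAnisotropic w → ¬ DiagonalValuesSubset v w := fun v w hv hw ↦ by
    obtain ⟨e, he⟩ := hw.exists_cons
    exact not_diagonalValuesSubset_of_extension
      (fun _ _ hv hw ↦ not_diagonalValuesSubset_three hv hw) hv he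
  interval_cases n
  · exact not_diagonalValuesSubset_of_extension two hv hw.cons_self
  · exact two v w hv hw
  · exact not_diagonalValuesSubset_three hv hw

/-- A symmetric matrix over `ℚ` is congruent to a diagonal one. -/
theorem Matrix.IsSymm.exists_diagonalization {n : ℕ} {S : Matrix (Fin n) (Fin n) ℚ}
    (hS : S.IsSymm) : ∃ (w : Fin n → ℚ) (f : (Fin n → ℚ) ≃ₗ[ℚ] (Fin n → ℚ)),
      (∀ x, x ⬝ᵥ (S *ᵥ x) = ∑ i, w i * f x i ^ 2) ∧ (S.det ≠ 0 → ∀ i, w i ≠ 0) := by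
  have hB : LinearMap.IsSymm (Matrix.toBilin' S) := ⟨fun x y ↦ by
    simp only [RingHom.id_apply]
    rw [Matrix.toBilin'_apply', Matrix.toBilin'_apply', dotProduct_mulVec,
      ← mulVec_transpose, hS.eq, dotProduct_comm]⟩
  obtain ⟨v, hv⟩ := LinearMap.BilinForm.exists_orthogonal_basis hB
  set b := v.reindex (finCongr (Module.finrank_fin_fun ℚ)) with hb
  have hbo : (Matrix.toBilin' S).IsOrthoᵢ b := fun i j hij ↦ by
    have := hv (i := (finCongr (Module.finrank_fin_fun ℚ)).symm i)
      (j := (finCongr (Module.finrank_fin_fun ℚ)).symm j) (by simpa using hij)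
    simpa [hb, Function.onFun] using this
  refine ⟨fun i ↦ Matrix.toBilin' S (b i) (b i), b.equivFun, fun x ↦ ?_, fun hS0 i ↦ ?_⟩
  · rw [← Matrix.toBilin'_apply']
    conv_lhs => rw [← b.sum_equivFun x]
    simp only [map_sum, LinearMap.sum_apply, map_smul, LinearMap.smul_apply]
    refine Finset.sum_congr rfl fun i _ ↦ ?_
    rw [Finset.sum_eq_single_of_mem i (Finset.mem_univ i) fun j _ hj ↦ ?_]
    · simp
      ring
    · simp [show Matrix.toBilin' S (b j) (b i) = 0 from hbo hj]
  · exact hbo.not_isOrtho_basis_self_of_separatingLeft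
      (LinearMap.BilinForm.nondegenerate_toBilin'_iff_det_ne_zero.mpr hS0).1 i

theorem stmt_13 (N N₂ : ℕ) (h₁ : 1 ≤ N₂) (h₂ : N₂ < min 4 N)
    (S : Matrix (Fin N) (Fin N) ℚ) (S₂ : Matrix (Fin N₂) (Fin N₂) ℚ)
    (hsS : S.IsSymm) (hsS₂ : S₂.IsSymm)
    (hdet : S.det ≠ 0)
    (haniso : ∀ y : Fin N₂ → ℚ, y ≠ 0 → y ⬝ᵥ (S₂ *ᵥ y) ≠ 0) :
    ¬ ({r : ℚ | ∃ x : Fin N → ℚ, x ≠ 0 ∧ x ⬝ᵥ (S *ᵥ x) = r} ⊆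
        {r : ℚ | ∃ y : Fin N₂ → ℚ, y ≠ 0 ∧ y ⬝ᵥ (S₂ *ᵥ y) = r}) := by
  intro H
  obtain ⟨v, f, hf, hv⟩ := hsS.exists_diagonalization
  obtain ⟨w, g, hg, -⟩ := hsS₂.exists_diagonalization
  have hN : N₂ + 1 ≤ N := by omega
  refine not_diagonalValuesSubset h₁ (by omega) (v := v ∘ Fin.castLE hN) (w := w)
    (fun i ↦ hv hdet _) (fun y hy h ↦ ?_) (fun x hx ↦ ?_)
  · refine haniso (g.symm y) (by simpa using hy) ?_
    rw [hg, g.apply_symm_apply, h]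
  · have hinj := Fin.castLE_injective hN
    set x' : Fin N → ℚ := Function.extend (Fin.castLE hN) x 0 with hx'
    have hx'x : ∀ i, x' (Fin.castLE hN i) = x i := fun i ↦ hinj.extend_apply x 0 i
    have hx'0 : x' ≠ 0 := fun h ↦ hx (by ext i; rw [← hx'x, h]; rfl)
    obtain ⟨y, hy, hyx⟩ := H ⟨f.symm x', by simpa using hx'0, rfl⟩
    refine ⟨g y, by simpa using hy, ?_⟩
    rw [← hg, hyx, hf, f.apply_symm_apply]
    refine Fintype.sum_of_injective _ hinj _ _ (fun i hi ↦ ?_) fun i ↦ ?_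
    · rw [hx', Function.extend_apply' _ _ _ hi]
      simp
    · simp [hx'x]
end

section
/- The pairs of ternary quadratic forms (A₁,B₁) = (x₁² − x₁x₂ + x₂², (x₁ + x₂ + 3x₃)²) and (A₂,B₂) = (x₁² + 3x₂², (x₁ + 3x₃)²) have identical simultaneous representations over ℤ: {(A₁(x), B₁(x)) : 0 ≠ x ∈ ℤ³} = {(A₂(x), B₂(x)) : 0 ≠ x ∈ ℤ³}. In particular, for all real numbers c, d, the ternary forms c(x₁² − x₁x₂ + x₂²) + d(x₁ + x₂ + 3x₃)² and c(x₁² + 3x₂²) + d(x₁ + 3x₃)² take exactly the same set of values on nonzero integer vectors. -/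
theorem exists_sq_add_three_mul_sq (x y : ℤ) :
    ∃ a b : ℤ, x ^ 2 - x * y + y ^ 2 = a ^ 2 + 3 * b ^ 2 := by
  rcases Int.even_or_odd' x with ⟨k, rfl | hx⟩
  · exact ⟨y - k, k, by ring⟩
  rcases Int.even_or_odd' y with ⟨l, rfl | hy⟩
  · exact ⟨x - l, l, by ring⟩
  exact ⟨y + (k - l), k - l, by subst hx hy; ring⟩

theorem exists_eq_or_neg_add_three_mul {t a : ℤ} (h : (3 : ℤ) ∣ t ^ 2 - a ^ 2) :
    ∃ w : ℤ, t = a + 3 * w ∨ t = -a + 3 * w := by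
  rw [sq_sub_sq] at h
  rcases Int.prime_three.dvd_or_dvd h with ⟨w, hw⟩ | ⟨w, hw⟩
  · exact ⟨w, Or.inr (by linarith)⟩
  · exact ⟨w, Or.inl (by linarith)⟩

theorem exists_second_pair_eq_first_pair (x : Fin 3 → ℤ) (hx : x ≠ 0) :
    ∃ y : Fin 3 → ℤ, y ≠ 0 ∧
      y 0 ^ 2 + 3 * y 1 ^ 2 = x 0 ^ 2 - x 0 * x 1 + x 1 ^ 2 ∧
      (y 0 + 3 * y 2) ^ 2 = (x 0 + x 1 + 3 * x 2) ^ 2 := by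
  obtain ⟨a, b, hab⟩ := exists_sq_add_three_mul_sq (x 0) (x 1)
  obtain ⟨c, w, hc, hw⟩ : ∃ c w : ℤ, c ^ 2 = a ^ 2 ∧ x 0 + x 1 + 3 * x 2 = c + 3 * w := by
    have h : (3 : ℤ) ∣ (x 0 + x 1 + 3 * x 2) ^ 2 - a ^ 2 :=
      ⟨x 0 * x 1 + 2 * (x 0 + x 1) * x 2 + 3 * x 2 ^ 2 + b ^ 2, by linear_combination hab⟩
    obtain ⟨w, hw | hw⟩ := exists_eq_or_neg_add_three_mul h
    · exact ⟨a, w, rfl, hw⟩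
    · exact ⟨-a, w, neg_sq a, hw⟩
  refine ⟨![c, b, w], fun h => hx ?_, ?_, ?_⟩
  · have hc0 : c = 0 := by simpa using congrFun h 0
    have hb0 : b = 0 := by simpa using congrFun h 1
    have hw0 : w = 0 := by simpa using congrFun h 2
    subst hc0 hb0 hw0
    have h0 : x 0 = 0 := by
      refine pow_eq_zero_iff two_ne_zero |>.mp ?_
      nlinarith [sq_nonneg (x 0), sq_nonneg (x 0 - 2 * x 1)]
    have h1 : x 1 = 0 := by
      refine pow_eq_zero_iff two_ne_zero |>.mp ?_
      nlinarith [sq_nonneg (x 1), sq_nonneg (x 1 - 2 * x 0)]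
    have h2 : x 2 = 0 := by linarith
    ext i
    fin_cases i <;> simp [h0, h1, h2]
  · simp only [Matrix.cons_val]
    linarith
  · simp [hw]

theorem exists_first_pair_eq_second_pair (x : Fin 3 → ℤ) (hx : x ≠ 0) :
    ∃ y : Fin 3 → ℤ, y ≠ 0 ∧
      y 0 ^ 2 - y 0 * y 1 + y 1 ^ 2 = x 0 ^ 2 + 3 * x 1 ^ 2 ∧
      (y 0 + y 1 + 3 * y 2) ^ 2 = (x 0 + 3 * x 2) ^ 2 := by
  refine ⟨![2 * x 1, x 0 + x 1, x 2 - x 1], fun h => hx ?_, ?_, ?_⟩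
  · have h0 : 2 * x 1 = 0 := by simpa using congrFun h 0
    have h1 : x 0 + x 1 = 0 := by simpa using congrFun h 1
    have h2 : x 2 - x 1 = 0 := by simpa using congrFun h 2
    ext i
    fin_cases i <;> simp <;> linarith
  · simp only [Matrix.cons_val]
    ring
  · simp only [Matrix.cons_val]
    ring


theorem stmt_14 :
    ({p : ℤ × ℤ | ∃ x : Fin 3 → ℤ, x ≠ 0 ∧
        (x 0 ^ 2 - x 0 * x 1 + x 1 ^ 2, (x 0 + x 1 + 3 * x 2) ^ 2) = p}
      = {p : ℤ × ℤ | ∃ x : Fin 3 → ℤ, x ≠ 0 ∧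
        (x 0 ^ 2 + 3 * x 1 ^ 2, (x 0 + 3 * x 2) ^ 2) = p}) ∧
    ∀ c d : ℝ,
      ({r : ℝ | ∃ x : Fin 3 → ℤ, x ≠ 0 ∧
          c * ((x 0 : ℝ) ^ 2 - (x 0 : ℝ) * (x 1 : ℝ) + (x 1 : ℝ) ^ 2)
            + d * ((x 0 : ℝ) + (x 1 : ℝ) + 3 * (x 2 : ℝ)) ^ 2 = r}
        = {r : ℝ | ∃ x : Fin 3 → ℤ, x ≠ 0 ∧
          c * ((x 0 : ℝ) ^ 2 + 3 * (x 1 : ℝ) ^ 2)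
            + d * ((x 0 : ℝ) + 3 * (x 2 : ℝ)) ^ 2 = r}) := by
  refine ⟨?_, fun c d => ?_⟩
  · ext p
    constructor
    · rintro ⟨x, hx, rfl⟩
      obtain ⟨y, hy, hA, hB⟩ := exists_second_pair_eq_first_pair x hx
      exact ⟨y, hy, Prod.ext hA hB⟩
    · rintro ⟨x, hx, rfl⟩
      obtain ⟨y, hy, hA, hB⟩ := exists_first_pair_eq_second_pair x hx
      exact ⟨y, hy, Prod.ext hA hB⟩
  · ext r
    constructor
    · rintro ⟨x, hx, rfl⟩
      obtain ⟨y, hy, hA, hB⟩ := exists_second_pair_eq_first_pair x hx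
      have hA' := congrArg (Int.cast : ℤ → ℝ) hA
      have hB' := congrArg (Int.cast : ℤ → ℝ) hB
      push_cast at hA' hB'
      exact ⟨y, hy, by rw [hA', hB']⟩
    · rintro ⟨x, hx, rfl⟩
      obtain ⟨y, hy, hA, hB⟩ := exists_first_pair_eq_second_pair x hx
      have hA' := congrArg (Int.cast : ℤ → ℝ) hA
      have hB' := congrArg (Int.cast : ℤ → ℝ) hB
      push_cast at hA' hB'
      exact ⟨y, hy, by rw [hA', hB']⟩
end
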